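/- arXiv:1703.10790 — 3 statements merged into one kernel-verified Lean document; each statement's English description precedes it below -/
import Mathlib

section
/- Let d ≥ 1 and let (p_t)_{t≥0} be the marginal laws of a Lévy process on ℝ^d with generating triplet (A, γ, ν). Let Ω, Ω₀ ⊂ ℝ^d be open sets of finite Lebesgue measure with dist(Ω, Ω₀) = D > 0, and set r(x) = |Ω ∩ (Ω₀ + x)| (Lebesgue measure of the intersection). Then lim_{t→0+} t^{−1} ∫_{ℝ^d} r(x) p_t(dx) = ∫_Ω ν(y − Ω₀) dy, where y − Ω₀ = {y − z : z ∈ Ω₀}. -/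
open MeasureTheory Filter
open scoped Topology RealInnerProductSpace ENNReal

section WeakConvergence

variable {E : Type*} [NormedAddCommGroup E] [InnerProductSpace ℝ E] [MeasurableSpace E]

theorem charFun_eq_integral_exp_I_mul (μ : Measure E) (ξ : E) :
    charFun μ ξ = ∫ x, Complex.exp (Complex.I * (⟪ξ, x⟫ : ℂ)) ∂μ := by
  rw [charFun_apply]
  congr with x
  rw [real_inner_comm, mul_comm]

theorem charFun_add_measure [OpensMeasurableSpace E] [SecondCountableTopology E]
    (μ ν : Measure E) [IsFiniteMeasure μ] [IsFiniteMeasure ν] (ξ : E) :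
    charFun (μ + ν) ξ = charFun μ ξ + charFun ν ξ := by
  simp only [charFun_eq_integral_innerProbChar]
  exact integral_add_measure (BoundedContinuousFunction.integrable μ _)
    (BoundedContinuousFunction.integrable ν _)

theorem charFun_smul_measure (c : ℝ≥0∞) (μ : Measure E) (ξ : E) :
    charFun (c • μ) ξ = c.toReal • charFun μ ξ := by
  simp only [charFun_apply, integral_smul_measure]

variable [FiniteDimensional ℝ E] [BorelSpace E]

/-- The Lévy convergence theorem for finite measures whose limit is nonzero. -/
theorem tendsto_integral_of_tendsto_charFun_of_ne_zero {μ : ℕ → Measure E} {μ₀ : Measure E}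
    [∀ n, IsFiniteMeasure (μ n)] [IsFiniteMeasure μ₀] (hne : ∀ n, μ n ≠ 0) (hne₀ : μ₀ ≠ 0)
    (h : ∀ ξ, Tendsto (fun n ↦ charFun (μ n) ξ) atTop (𝓝 (charFun μ₀ ξ)))
    (f : BoundedContinuousFunction E ℝ) :
    Tendsto (fun n ↦ ∫ x, f x ∂(μ n)) atTop (𝓝 (∫ x, f x ∂μ₀)) := by
  have : ∀ n, NeZero (μ n) := fun n ↦ ⟨hne n⟩
  have : NeZero μ₀ := ⟨hne₀⟩
  have hmass : Tendsto (fun n ↦ (μ n).real Set.univ) atTop (𝓝 (μ₀.real Set.univ)) := by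
    have h0 := h 0
    simp only [charFun_zero] at h0
    exact_mod_cast (Complex.continuous_re.tendsto _).comp h0
  have hpos : μ₀.real Set.univ ≠ 0 := by simp [measureReal_eq_zero_iff, hne₀]
  have hposn : ∀ n, (μ n).real Set.univ ≠ 0 := fun n ↦ by simp [measureReal_eq_zero_iff, hne n]
  let P : ℕ → ProbabilityMeasure E := fun n ↦ ⟨(μ n Set.univ)⁻¹ • μ n, inferInstance⟩
  let P₀ : ProbabilityMeasure E := ⟨(μ₀ Set.univ)⁻¹ • μ₀, inferInstance⟩
  have hP : Tendsto P atTop (𝓝 P₀) := by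
    refine ProbabilityMeasure.tendsto_of_tendsto_charFun fun ξ ↦ ?_
    simp only [P, P₀, ProbabilityMeasure.coe_mk, charFun_smul_measure, ENNReal.toReal_inv]
    exact (hmass.inv₀ hpos).smul (h ξ)
  have hlim := hmass.mul (ProbabilityMeasure.tendsto_iff_forall_integral_tendsto.1 hP f)
  simp only [P, P₀, ProbabilityMeasure.coe_mk, integral_smul_measure, ENNReal.toReal_inv,
    smul_eq_mul] at hlim
  simp only [Measure.real] at hpos hposn hlim
  simpa only [mul_inv_cancel_left₀ hpos, fun n ↦ mul_inv_cancel_left₀ (hposn n)] using hlim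

/-- The Lévy convergence theorem for finite measures. -/
theorem tendsto_integral_of_tendsto_charFun {μ : ℕ → Measure E} {μ₀ : Measure E}
    [∀ n, IsFiniteMeasure (μ n)] [IsFiniteMeasure μ₀]
    (h : ∀ ξ, Tendsto (fun n ↦ charFun (μ n) ξ) atTop (𝓝 (charFun μ₀ ξ)))
    (f : BoundedContinuousFunction E ℝ) :
    Tendsto (fun n ↦ ∫ x, f x ∂(μ n)) atTop (𝓝 (∫ x, f x ∂μ₀)) := by
  have hne : ∀ μ : Measure E, μ + Measure.dirac 0 ≠ 0 := fun μ h0 ↦ by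
    have := congrArg (fun m : Measure E ↦ m Set.univ) h0
    simp at this
  have hlim := tendsto_integral_of_tendsto_charFun_of_ne_zero
    (μ := fun n ↦ μ n + Measure.dirac 0) (μ₀ := μ₀ + Measure.dirac 0) (fun n ↦ hne _) (hne _)
    (fun ξ ↦ by simpa only [charFun_add_measure] using (h ξ).add_const _) f
  have hadd : ∀ μ : Measure E, IsFiniteMeasure μ →
      ∫ x, f x ∂(μ + Measure.dirac 0) = ∫ x, f x ∂μ + f 0 := fun μ _ ↦ by
    rw [integral_add_measure (f.integrable μ) (f.integrable _), integral_dirac]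
  simpa [hadd] using hlim.sub_const (f 0)

end WeakConvergence

theorem Complex.norm_exp_neg_sub_one_le {z : ℂ} (hz : 0 ≤ z.re) :
    ‖Complex.exp (-z) - 1‖ ≤ ‖z‖ := by
  have hc : Convex ℝ {w : ℂ | w.re ≤ 0} := convex_halfSpace_re_le 0
  have := hc.norm_image_sub_le_of_norm_hasDerivWithin_le (f := Complex.exp) (f' := Complex.exp)
    (C := 1) (x := 0) (y := -z) (fun x _ ↦ (Complex.hasDerivAt_exp x).hasDerivWithinAt)
    (fun x hx ↦ by simpa [Complex.norm_exp] using hx) (by simp) (by simpa using hz)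
  simpa using this

theorem norm_exp_I_mul_ofReal_sub_one_sub_le (x : ℝ) :
    ‖Complex.exp (Complex.I * x) - 1 - Complex.I * x‖ ≤ 2 * x ^ 2 := by
  have hn : ‖Complex.I * (x : ℂ)‖ = |x| := by simp
  rcases le_total |x| 1 with h | h
  · have := Complex.norm_exp_sub_one_sub_id_le (x := Complex.I * x) (by rwa [hn])
    rw [hn, sq_abs] at this
    nlinarith [sq_nonneg x]
  · calc _ ≤ ‖Complex.exp (Complex.I * x) - 1‖ + ‖Complex.I * (x : ℂ)‖ := norm_sub_le _ _
      _ ≤ |x| + |x| := by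
        rw [hn]; gcongr; simpa using Real.norm_exp_I_mul_ofReal_sub_one_le (x := x)
      _ ≤ 2 * x ^ 2 := by rw [← sq_abs x]; nlinarith

section LevyMeasure

open ProbabilityTheory

variable {E : Type*} [NormedAddCommGroup E]

theorem one_sub_exp_neg_sq_nonneg (y : E) : 0 ≤ 1 - Real.exp (-‖y‖ ^ 2 / 2) := by
  rw [sub_nonneg, Real.exp_le_one_iff]
  nlinarith [sq_nonneg ‖y‖]

theorem one_sub_exp_neg_sq_le_min (y : E) :
    1 - Real.exp (-‖y‖ ^ 2 / 2) ≤ min 1 (‖y‖ ^ 2) := by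
  refine le_min (by linarith [Real.exp_pos (-‖y‖ ^ 2 / 2)]) ?_
  nlinarith [Real.add_one_le_exp (-‖y‖ ^ 2 / 2), sq_nonneg ‖y‖]

variable [MeasurableSpace E] {ν : Measure E}

theorem integrable_min_one_sq [OpensMeasurableSpace E]
    (hν : ∫⁻ y, ENNReal.ofReal (min 1 (‖y‖ ^ 2)) ∂ν < ⊤) :
    Integrable (fun y ↦ min 1 (‖y‖ ^ 2)) ν := by
  refine ⟨by fun_prop, ?_⟩
  rwa [hasFiniteIntegral_iff_ofReal (ae_of_all _ fun y ↦ by positivity)]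

theorem measure_lt_top_of_le_norm (hν : Integrable (fun y ↦ min 1 (‖y‖ ^ 2)) ν) {δ : ℝ}
    (hδ : 0 < δ) : ν {y | δ ≤ ‖y‖} < ⊤ := by
  refine lt_of_le_of_lt (measure_mono fun y hy ↦ ?_)
    (hν.measure_ge_lt_top (ε := min 1 (δ ^ 2)) (by positivity))
  have hy' : δ ≤ ‖y‖ := hy
  exact min_le_min_left _ (pow_le_pow_left₀ hδ.le hy' 2)

theorem sigmaFinite_of_integrable_min_one_sq (h0 : ν {0} = 0)
    (hν : Integrable (fun y ↦ min 1 (‖y‖ ^ 2)) ν) : SigmaFinite ν := by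
  refine Measure.sigmaFinite_of_countable
    (S := insert {0} (Set.range fun n : ℕ ↦ {y : E | 1 / ((n : ℝ) + 1) ≤ ‖y‖}))
    ((Set.countable_range _).insert _) ?_ ?_
  · rintro s (rfl | ⟨n, rfl⟩)
    · simp [h0]
    · exact measure_lt_top_of_le_norm hν (by positivity)
  · refine Set.eq_univ_of_forall fun y ↦ ?_
    by_cases hy : y = 0
    · exact ⟨{0}, Set.mem_insert _ _, hy⟩
    · obtain ⟨n, hn⟩ := exists_nat_one_div_lt (norm_pos_iff.2 hy)
      exact ⟨_, Set.mem_insert_of_mem _ ⟨n, rfl⟩, hn.le⟩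

variable [InnerProductSpace ℝ E]

/-- The compensated exponential integrated against a Lévy measure in the Lévy–Khintchine formula. -/
noncomputable def levyKernel (ξ y : E) : ℂ :=
  Complex.exp (Complex.I * (⟪ξ, y⟫ : ℂ)) - 1
    - Complex.I * (if ‖y‖ ≤ 1 then (⟪ξ, y⟫ : ℂ) else 0)

omit [MeasurableSpace E] in
theorem norm_levyKernel_le (ξ y : E) :
    ‖levyKernel ξ y‖ ≤ (2 + 2 * ‖ξ‖ ^ 2) * min 1 (‖y‖ ^ 2) := by
  unfold levyKernel
  split_ifs with h
  · rw [min_eq_right (pow_le_one₀ (norm_nonneg y) h)]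
    have hcs : ⟪ξ, y⟫ ^ 2 ≤ ‖ξ‖ ^ 2 * ‖y‖ ^ 2 := by
      rw [← mul_pow, ← sq_abs]
      gcongr
      exact abs_real_inner_le_norm ξ y
    have := norm_exp_I_mul_ofReal_sub_one_sub_le ⟪ξ, y⟫
    nlinarith [sq_nonneg ‖y‖]
  · rw [min_eq_left (one_le_pow₀ (not_le.1 h).le), mul_zero, sub_zero, mul_one]
    have : ‖Complex.exp (Complex.I * (⟪ξ, y⟫ : ℂ)) - 1‖ ≤ 1 + 1 := by
      refine (norm_sub_le _ _).trans ?_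
      rw [mul_comm, Complex.norm_exp_ofReal_mul_I, norm_one]
    nlinarith [sq_nonneg ‖ξ‖]

variable [FiniteDimensional ℝ E] [BorelSpace E]

theorem measurable_uncurry_levyKernel : Measurable (fun p : E × E ↦ levyKernel p.1 p.2) := by
  unfold levyKernel
  refine Measurable.sub (by fun_prop) (Measurable.const_mul ?_ _)
  exact Measurable.ite (measurableSet_le (by fun_prop) measurable_const) (by fun_prop)
    measurable_const

theorem integrable_levyKernel (hν : Integrable (fun y ↦ min 1 (‖y‖ ^ 2)) ν) (ξ : E) :
    Integrable (levyKernel ξ) ν :=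
  (hν.const_mul (2 + 2 * ‖ξ‖ ^ 2)).mono'
    (measurable_uncurry_levyKernel.comp measurable_prodMk_left).aestronglyMeasurable
    (ae_of_all _ (norm_levyKernel_le ξ))

theorem integrable_norm_sq_stdGaussian : Integrable (fun η : E ↦ ‖η‖ ^ 2) (stdGaussian E) :=
  (IsGaussian.memLp_two_id (μ := stdGaussian E)).integrable_norm_pow (by norm_num)

theorem integrable_one_add_norm_add_sq_stdGaussian (ξ : E) :
    Integrable (fun η : E ↦ 1 + ‖ξ + η‖ ^ 2) (stdGaussian E) := by
  refine ((integrable_const (1 + 2 * ‖ξ‖ ^ 2)).add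
    (integrable_norm_sq_stdGaussian.const_mul 2)).mono' (by fun_prop) (ae_of_all _ fun η ↦ ?_)
  rw [Real.norm_of_nonneg (by positivity)]
  have : ‖ξ + η‖ ^ 2 ≤ (‖ξ‖ + ‖η‖) ^ 2 := by gcongr; exact norm_add_le _ _
  simp only [Pi.add_apply]
  nlinarith [sq_nonneg (‖ξ‖ - ‖η‖)]

theorem integrable_inner_stdGaussian (y : E) :
    Integrable (fun η ↦ ⟪η, y⟫) (stdGaussian E) := by
  simpa [real_inner_comm] using IsGaussian.integrable_dual (stdGaussian E) (innerSL ℝ y)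

theorem integral_inner_stdGaussian (y : E) : ∫ η, ⟪η, y⟫ ∂(stdGaussian E) = 0 := by
  simpa [real_inner_comm] using integral_strongDual_stdGaussian (innerSL ℝ y)

theorem integrable_exp_I_mul_inner (μ : Measure E) [IsFiniteMeasure μ] (ξ : E) :
    Integrable (fun x ↦ Complex.exp (Complex.I * (⟪ξ, x⟫ : ℂ))) μ := by
  refine (integrable_const (1 : ℝ)).mono' (by fun_prop) (ae_of_all _ fun x ↦ ?_)
  rw [mul_comm, Complex.norm_exp_ofReal_mul_I]

theorem integral_exp_I_mul_inner_add_stdGaussian (ξ y : E) :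
    ∫ η, Complex.exp (Complex.I * (⟪ξ + η, y⟫ : ℂ)) ∂(stdGaussian E)
      = Complex.exp (Complex.I * (⟪ξ, y⟫ : ℂ)) * (Real.exp (-‖y‖ ^ 2 / 2) : ℂ) := by
  have : ∀ η : E, Complex.exp (Complex.I * (⟪ξ + η, y⟫ : ℂ))
      = Complex.exp (Complex.I * (⟪ξ, y⟫ : ℂ)) * Complex.exp (Complex.I * (⟪y, η⟫ : ℂ)) := by
    intro η
    rw [← Complex.exp_add, inner_add_left, real_inner_comm η y]
    push_cast
    ring_nf
  simp_rw [this]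
  rw [integral_const_mul, ← charFun_eq_integral_exp_I_mul, charFun_stdGaussian]
  push_cast
  rfl

theorem integral_levyKernel_add_sub_stdGaussian (ξ y : E) :
    ∫ η, (levyKernel (ξ + η) y - levyKernel ξ y) ∂(stdGaussian E)
      = -(Complex.exp (Complex.I * (⟪ξ, y⟫ : ℂ)) * (1 - Real.exp (-‖y‖ ^ 2 / 2) : ℝ)) := by
  have hk : ∀ η, levyKernel (ξ + η) y - levyKernel ξ y
      = Complex.exp (Complex.I * (⟪ξ + η, y⟫ : ℂ)) - Complex.exp (Complex.I * (⟪ξ, y⟫ : ℂ))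
        - (if ‖y‖ ≤ 1 then Complex.I else 0) * (⟪η, y⟫ : ℂ) := by
    intro η
    unfold levyKernel
    rw [inner_add_left]
    split_ifs <;> push_cast <;> ring
  have hint : Integrable (fun η ↦ Complex.exp (Complex.I * (⟪ξ + η, y⟫ : ℂ))) (stdGaussian E) := by
    refine (integrable_const (1 : ℝ)).mono' (by fun_prop) (ae_of_all _ fun x ↦ ?_)
    rw [mul_comm, Complex.norm_exp_ofReal_mul_I]
  have hlin : Integrable (fun η : E ↦ ((⟪η, y⟫ : ℝ) : ℂ)) (stdGaussian E) :=
    (integrable_inner_stdGaussian y).ofReal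
  have hsub : Integrable (fun η ↦ Complex.exp (Complex.I * (⟪ξ + η, y⟫ : ℂ))
      - Complex.exp (Complex.I * (⟪ξ, y⟫ : ℂ))) (stdGaussian E) := hint.sub (integrable_const _)
  simp_rw [hk]
  rw [integral_sub hsub (hlin.const_mul _),
    integral_sub hint (integrable_const _), integral_exp_I_mul_inner_add_stdGaussian,
    integral_const_mul, integral_complex_ofReal, integral_inner_stdGaussian]
  simp
  ring

/-- Gaussian averaging of the increments turns the jump part of a characteristic exponent into the
characteristic function of a finite measure. -/
theorem integral_integral_levyKernel_add_sub_stdGaussian [SFinite ν]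
    (hν : Integrable (fun y ↦ min 1 (‖y‖ ^ 2)) ν) (ξ : E) :
    ∫ η, (∫ y, levyKernel (ξ + η) y ∂ν - ∫ y, levyKernel ξ y ∂ν) ∂(stdGaussian E)
      = -∫ y, Complex.exp (Complex.I * (⟪ξ, y⟫ : ℂ)) * (1 - Real.exp (-‖y‖ ^ 2 / 2) : ℝ) ∂ν := by
  have hprod : Integrable (fun p : E × E ↦ levyKernel (ξ + p.1) p.2 - levyKernel ξ p.2)
      ((stdGaussian E).prod ν) := by
    have hdom := (((integrable_one_add_norm_add_sq_stdGaussian ξ).add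
      (integrable_const (1 + ‖ξ‖ ^ 2))).const_mul 2).mul_prod hν
    refine hdom.mono' (Measurable.aestronglyMeasurable ?_) (ae_of_all _ fun p ↦ ?_)
    · exact (measurable_uncurry_levyKernel.comp (f := fun p : E × E ↦ (ξ + p.1, p.2))
        (by fun_prop)).sub (measurable_uncurry_levyKernel.comp (f := fun p : E × E ↦ (ξ, p.2))
        (by fun_prop))
    · refine (norm_sub_le _ _).trans ?_
      have h₁ := norm_levyKernel_le (ξ + p.1) p.2
      have h₂ := norm_levyKernel_le ξ p.2
      simp only [Pi.add_apply]
      linarith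
  simp_rw [← fun η ↦ integral_sub (integrable_levyKernel hν (ξ + η)) (integrable_levyKernel hν ξ)]
  rw [integral_integral_swap hprod, ← integral_neg]
  simp_rw [integral_levyKernel_add_sub_stdGaussian]

theorem measurable_integral_levyKernel [SFinite ν] :
    Measurable (fun ξ : E ↦ ∫ y, levyKernel ξ y ∂ν) :=
  (measurable_uncurry_levyKernel (E := E)).stronglyMeasurable.integral_prod_right.measurable

omit [FiniteDimensional ℝ E] [BorelSpace E] in
theorem norm_integral_levyKernel_le (hν : Integrable (fun y ↦ min 1 (‖y‖ ^ 2)) ν) (ξ : E) :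
    ‖∫ y, levyKernel ξ y ∂ν‖ ≤ (2 + 2 * ‖ξ‖ ^ 2) * ∫ y, min 1 (‖y‖ ^ 2) ∂ν := by
  rw [← integral_const_mul]
  exact norm_integral_le_of_norm_le (hν.const_mul _) (ae_of_all _ (norm_levyKernel_le ξ))

theorem integrable_integral_levyKernel_add [SFinite ν]
    (hν : Integrable (fun y ↦ min 1 (‖y‖ ^ 2)) ν) (ξ : E) :
    Integrable (fun η ↦ ∫ y, levyKernel (ξ + η) y ∂ν) (stdGaussian E) := by
  refine ((integrable_one_add_norm_add_sq_stdGaussian ξ).const_mul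
    (2 * ∫ y, min 1 (‖y‖ ^ 2) ∂ν)).mono'
    (measurable_integral_levyKernel.comp (measurable_const_add ξ)).aestronglyMeasurable
    (ae_of_all _ fun η ↦ (norm_integral_levyKernel_le hν (ξ + η)).trans_eq (by ring))

/-- The characteristic exponent of the generating triplet `(A, γ, ν)`. -/
noncomputable def levyExponent (A : E →L[ℝ] E) (γ : E) (ν : Measure E) (ξ : E) : ℂ :=
  (⟪ξ, A ξ⟫ : ℂ) - Complex.I * (⟪ξ, γ⟫ : ℂ) - ∫ y, levyKernel ξ y ∂ν

variable {A : E →L[ℝ] E} {γ : E}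

theorem integrable_inner_map_self_stdGaussian (A : E →L[ℝ] E) :
    Integrable (fun η ↦ ⟪η, A η⟫) (stdGaussian E) := by
  refine (integrable_norm_sq_stdGaussian.const_mul ‖A‖).mono' (by fun_prop)
    (ae_of_all _ fun η ↦ ?_)
  calc ‖⟪η, A η⟫‖ ≤ ‖η‖ * ‖A η‖ := norm_inner_le_norm _ _
    _ ≤ ‖η‖ * (‖A‖ * ‖η‖) := by gcongr; exact A.le_opNorm η
    _ = ‖A‖ * ‖η‖ ^ 2 := by ring

omit [FiniteDimensional ℝ E] [BorelSpace E] in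
theorem levyExponent_add_sub (hA : ∀ x y, ⟪A x, y⟫ = ⟪x, A y⟫) (ξ η : E) :
    levyExponent A γ ν (ξ + η) - levyExponent A γ ν ξ
      = (⟪η, A η⟫ : ℂ) + (2 * (⟪η, A ξ⟫ : ℂ) - Complex.I * (⟪η, γ⟫ : ℂ))
        - (∫ y, levyKernel (ξ + η) y ∂ν - ∫ y, levyKernel ξ y ∂ν) := by
  have h : ⟪ξ, A η⟫ = ⟪η, A ξ⟫ := by rw [← hA, real_inner_comm]
  simp only [levyExponent, map_add, inner_add_left, inner_add_right, h]
  push_cast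
  ring

theorem integrable_levyExponent_add_sub_stdGaussian [SFinite ν]
    (hA : ∀ x y, ⟪A x, y⟫ = ⟪x, A y⟫) (hν : Integrable (fun y ↦ min 1 (‖y‖ ^ 2)) ν) (ξ : E) :
    Integrable (fun η ↦ levyExponent A γ ν (ξ + η) - levyExponent A γ ν ξ) (stdGaussian E) := by
  simp_rw [levyExponent_add_sub hA]
  exact ((integrable_inner_map_self_stdGaussian A).ofReal.add
    (((integrable_inner_stdGaussian (A ξ)).ofReal.const_mul 2).sub
      ((integrable_inner_stdGaussian γ).ofReal.const_mul _))).sub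
    ((integrable_integral_levyKernel_add hν ξ).sub (integrable_const _))

theorem integral_levyExponent_add_sub_stdGaussian [SFinite ν]
    (hA : ∀ x y, ⟪A x, y⟫ = ⟪x, A y⟫) (hν : Integrable (fun y ↦ min 1 (‖y‖ ^ 2)) ν) (ξ : E) :
    ∫ η, (levyExponent A γ ν (ξ + η) - levyExponent A γ ν ξ) ∂(stdGaussian E)
      = ∫ y, Complex.exp (Complex.I * (⟪ξ, y⟫ : ℂ)) * (1 - Real.exp (-‖y‖ ^ 2 / 2) : ℝ) ∂ν
        + (∫ η, ⟪η, A η⟫ ∂(stdGaussian E) : ℝ) := by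
  have hquad : Integrable (fun η : E ↦ ((⟪η, A η⟫ : ℝ) : ℂ)) (stdGaussian E) :=
    (integrable_inner_map_self_stdGaussian A).ofReal
  have hlin : ∀ y : E, Integrable (fun η : E ↦ ((⟪η, y⟫ : ℝ) : ℂ)) (stdGaussian E) :=
    fun y ↦ (integrable_inner_stdGaussian y).ofReal
  have hlin' : Integrable (fun η : E ↦ 2 * ((⟪η, A ξ⟫ : ℝ) : ℂ)
      - Complex.I * ((⟪η, γ⟫ : ℝ) : ℂ)) (stdGaussian E) :=
    ((hlin (A ξ)).const_mul 2).sub ((hlin γ).const_mul _)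
  have hsum : Integrable (fun η : E ↦ ((⟪η, A η⟫ : ℝ) : ℂ) + (2 * ((⟪η, A ξ⟫ : ℝ) : ℂ)
      - Complex.I * ((⟪η, γ⟫ : ℝ) : ℂ))) (stdGaussian E) := hquad.add hlin'
  have hjump : Integrable (fun η ↦ ∫ y, levyKernel (ξ + η) y ∂ν - ∫ y, levyKernel ξ y ∂ν)
      (stdGaussian E) := (integrable_integral_levyKernel_add hν ξ).sub (integrable_const _)
  simp_rw [levyExponent_add_sub hA]
  rw [integral_sub hsum hjump, integral_add hquad hlin',
    integral_sub ((hlin (A ξ)).const_mul 2) ((hlin γ).const_mul _), integral_const_mul,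
    integral_const_mul, integral_integral_levyKernel_add_sub_stdGaussian hν]
  simp only [integral_complex_ofReal, integral_inner_stdGaussian]
  push_cast
  ring

end LevyMeasure

section GaussianDamping

open ProbabilityTheory

variable {E : Type*} [NormedAddCommGroup E] [MeasurableSpace E] [OpensMeasurableSpace E]

/-- The measure `(1 - exp (-‖x‖² / 2)) μ(dx)`. -/
noncomputable def gaussianDamped (μ : Measure E) : Measure E :=
  μ.withDensity fun x ↦ ENNReal.ofReal (1 - Real.exp (-‖x‖ ^ 2 / 2))

theorem integral_gaussianDamped {F : Type*} [NormedAddCommGroup F] [NormedSpace ℝ F]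
    (μ : Measure E) (f : E → F) :
    ∫ x, f x ∂(gaussianDamped μ) = ∫ x, (1 - Real.exp (-‖x‖ ^ 2 / 2)) • f x ∂μ := by
  rw [gaussianDamped, integral_withDensity_eq_integral_toReal_smul (by fun_prop)
    (ae_of_all _ fun x ↦ ENNReal.ofReal_lt_top)]
  simp_rw [ENNReal.toReal_ofReal (one_sub_exp_neg_sq_nonneg _)]

theorem isFiniteMeasure_gaussianDamped {μ : Measure E}
    (hμ : Integrable (fun y ↦ min 1 (‖y‖ ^ 2)) μ) : IsFiniteMeasure (gaussianDamped μ) := by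
  refine isFiniteMeasure_withDensity_ofReal (hμ.mono' (by fun_prop) (ae_of_all _ fun y ↦ ?_)).2
  rw [Real.norm_of_nonneg (one_sub_exp_neg_sq_nonneg y)]
  exact one_sub_exp_neg_sq_le_min y

theorem integrable_min_one_sq_of_isFiniteMeasure (μ : Measure E) [IsFiniteMeasure μ] :
    Integrable (fun y ↦ min 1 (‖y‖ ^ 2)) μ := by
  refine (integrable_const (1 : ℝ)).mono' (by fun_prop) (ae_of_all _ fun y ↦ ?_)
  rw [Real.norm_of_nonneg (by positivity)]
  exact min_le_left _ _

variable [InnerProductSpace ℝ E]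

theorem charFun_gaussianDamped (μ : Measure E) (ξ : E) :
    charFun (gaussianDamped μ) ξ
      = ∫ y, Complex.exp (Complex.I * (⟪ξ, y⟫ : ℂ)) * (1 - Real.exp (-‖y‖ ^ 2 / 2) : ℝ) ∂μ := by
  rw [charFun_eq_integral_exp_I_mul, integral_gaussianDamped]
  simp_rw [Complex.real_smul, mul_comm]

variable [FiniteDimensional ℝ E] [BorelSpace E]

theorem charFun_gaussianDamped_eq_integral_stdGaussian (μ : Measure E) [IsFiniteMeasure μ]
    (ξ : E) :
    charFun (gaussianDamped μ) ξ
      = ∫ η, (charFun μ ξ - charFun μ (ξ + η)) ∂(stdGaussian E) := by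
  have hprod : Integrable (fun p : E × E ↦ Complex.exp (Complex.I * (⟪ξ, p.2⟫ : ℂ))
      - Complex.exp (Complex.I * (⟪ξ + p.1, p.2⟫ : ℂ))) ((stdGaussian E).prod μ) := by
    refine (integrable_const (1 + 1 : ℝ)).mono' (by fun_prop) (ae_of_all _ fun p ↦ ?_)
    refine (norm_sub_le _ _).trans_eq ?_
    rw [mul_comm, Complex.norm_exp_ofReal_mul_I, mul_comm, Complex.norm_exp_ofReal_mul_I]
  have hint : ∀ y : E, Integrable (fun η ↦ Complex.exp (Complex.I * (⟪ξ + η, y⟫ : ℂ)))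
      (stdGaussian E) := fun y ↦ by
    refine (integrable_const (1 : ℝ)).mono' (by fun_prop) (ae_of_all _ fun x ↦ ?_)
    rw [mul_comm, Complex.norm_exp_ofReal_mul_I]
  simp_rw [charFun_gaussianDamped, charFun_eq_integral_exp_I_mul,
    ← fun η ↦ integral_sub (integrable_exp_I_mul_inner μ ξ) (integrable_exp_I_mul_inner μ (ξ + η))]
  rw [integral_integral_swap hprod]
  congr with y
  rw [integral_sub (integrable_const _) (hint y), integral_exp_I_mul_inner_add_stdGaussian]
  simp
  ring

end GaussianDamping

section SmallTime

open ProbabilityTheory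

theorem tendsto_inv_mul_exp_neg_mul_sub (a b : ℂ) :
    Tendsto (fun t : ℝ ↦ (t : ℂ)⁻¹ * (Complex.exp (-(t : ℂ) * a) - Complex.exp (-(t : ℂ) * b)))
      (𝓝[>] 0) (𝓝 (b - a)) := by
  have hd : ∀ c : ℂ, HasDerivAt (fun t : ℝ ↦ Complex.exp (-(t : ℂ) * c)) (-c) 0 := fun c ↦ by
    have h : HasDerivAt (fun t : ℝ ↦ -(t : ℂ) * c) (-1 * c) 0 :=
      ((Complex.ofRealCLM.hasDerivAt (x := (0 : ℝ))).neg).mul_const c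
    simpa using h.cexp
  have h := (((hd a).sub (hd b)).tendsto_slope_zero_right)
  simp only [Pi.sub_apply, zero_add, Complex.ofReal_zero, neg_zero, zero_mul, sub_self, sub_zero,
    Complex.real_smul, Complex.ofReal_inv] at h
  rwa [neg_sub_neg] at h

theorem norm_inv_mul_exp_neg_mul_sub_le {t : ℝ} (ht : 0 < t) {a b : ℂ} (ha : 0 ≤ a.re)
    (hb : 0 ≤ b.re) :
    ‖(t : ℂ)⁻¹ * (Complex.exp (-(t : ℂ) * a) - Complex.exp (-(t : ℂ) * b))‖ ≤ ‖a‖ + ‖b‖ := by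
  have key : ∀ c : ℂ, 0 ≤ c.re → ‖Complex.exp (-(t : ℂ) * c) - 1‖ ≤ t * ‖c‖ := fun c hc ↦ by
    have := Complex.norm_exp_neg_sub_one_le (z := t * c) (by simpa using mul_nonneg ht.le hc)
    rwa [norm_mul, Complex.norm_real, Real.norm_of_nonneg ht.le, ← neg_mul] at this
  have h := norm_sub_le (Complex.exp (-(t : ℂ) * a) - 1) (Complex.exp (-(t : ℂ) * b) - 1)
  rw [sub_sub_sub_cancel_right] at h
  rw [norm_mul, norm_inv, Complex.norm_real, Real.norm_of_nonneg ht.le, inv_mul_le_iff₀ ht, mul_add]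
  linarith [key a ha, key b hb]

theorem tendsto_integral_inv_mul_exp_neg_mul_sub {α : Type*} [MeasurableSpace α] {μ : Measure α}
    [IsFiniteMeasure μ] {a : ℂ} (ha : 0 ≤ a.re) {b : α → ℂ} (hb : ∀ x, 0 ≤ (b x).re)
    (hint : Integrable b μ) :
    Tendsto (fun t : ℝ ↦ ∫ x, (t : ℂ)⁻¹ *
        (Complex.exp (-(t : ℂ) * a) - Complex.exp (-(t : ℂ) * b x)) ∂μ)
      (𝓝[>] 0) (𝓝 (∫ x, (b x - a) ∂μ)) := by
  refine tendsto_integral_filter_of_dominated_convergence (fun x ↦ ‖a‖ + ‖b x‖)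
    (Eventually.of_forall fun t ↦ ?_) ?_ ((integrable_const _).add hint.norm)
    (ae_of_all _ fun x ↦ tendsto_inv_mul_exp_neg_mul_sub a (b x))
  · exact (aestronglyMeasurable_const.sub (Complex.continuous_exp.comp_aestronglyMeasurable
      (hint.aestronglyMeasurable.const_mul _))).const_mul _
  · filter_upwards [self_mem_nhdsWithin] with t ht
    exact ae_of_all _ fun x ↦ norm_inv_mul_exp_neg_mul_sub_le ht ha (hb x)

variable {E : Type*} [NormedAddCommGroup E] [InnerProductSpace ℝ E] [MeasurableSpace E]
  {p : ℝ → Measure E}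

theorem re_nonneg_of_charFun_eq_exp_neg {μ : Measure E} [IsProbabilityMeasure μ] {ξ : E} {z : ℂ}
    (h : charFun μ ξ = Complex.exp (-z)) : 0 ≤ z.re := by
  have := norm_charFun_le_one (μ := μ) ξ
  rw [h, Complex.norm_exp, Real.exp_le_one_iff] at this
  simpa using this

variable [FiniteDimensional ℝ E] [BorelSpace E] {A : E →L[ℝ] E} {γ : E} {ν : Measure E}

theorem tendsto_charFun_inv_smul_gaussianDamped [SFinite ν]
    (hAsym : ∀ x y, ⟪A x, y⟫ = ⟪x, A y⟫) (hApos : ∀ x, 0 ≤ ⟪x, A x⟫)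
    (hν : Integrable (fun y ↦ min 1 (‖y‖ ^ 2)) ν)
    (hp : ∀ t, 0 ≤ t → IsProbabilityMeasure (p t))
    (hchar : ∀ t, 0 ≤ t → ∀ ξ,
      charFun (p t) ξ = Complex.exp (-(t : ℂ) * levyExponent A γ ν ξ)) (ξ : E) :
    Tendsto (fun t : ℝ ↦ charFun (ENNReal.ofReal t⁻¹ • gaussianDamped (p t)) ξ) (𝓝[>] 0)
      (𝓝 (charFun (gaussianDamped ν
        + ENNReal.ofReal (∫ η, ⟪η, A η⟫ ∂(stdGaussian E)) • Measure.dirac 0) ξ)) := by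
  have hre : ∀ ξ, 0 ≤ (levyExponent A γ ν ξ).re := fun ξ ↦ by
    have := hp 1 zero_le_one
    exact re_nonneg_of_charFun_eq_exp_neg (μ := p 1) (by simpa using hchar 1 zero_le_one ξ)
  have hint : Integrable (fun η ↦ levyExponent A γ ν (ξ + η)) (stdGaussian E) := by
    refine ((integrable_levyExponent_add_sub_stdGaussian (γ := γ) hAsym hν ξ).add
      (integrable_const (levyExponent A γ ν ξ))).congr (ae_of_all _ fun η ↦ ?_)
    simp
  have hlim := tendsto_integral_inv_mul_exp_neg_mul_sub (hre ξ) (fun η ↦ hre (ξ + η)) hint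
  have := isFiniteMeasure_gaussianDamped hν
  have := Measure.smul_finite (Measure.dirac (0 : E))
    (ENNReal.ofReal_ne_top (r := ∫ η, ⟪η, A η⟫ ∂(stdGaussian E)))
  rw [integral_levyExponent_add_sub_stdGaussian hAsym hν, ← charFun_gaussianDamped] at hlim
  rw [charFun_add_measure, charFun_smul_measure, charFun_dirac,
    ENNReal.toReal_ofReal (integral_nonneg hApos)]
  simp only [inner_zero_left, Complex.ofReal_zero, zero_mul, Complex.exp_zero, Complex.real_smul,
    mul_one]
  refine hlim.congr' ?_
  filter_upwards [self_mem_nhdsWithin] with t ht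
  have ht : 0 < t := ht
  have := hp t ht.le
  rw [charFun_smul_measure, ENNReal.toReal_ofReal (inv_nonneg.2 ht.le),
    charFun_gaussianDamped_eq_integral_stdGaussian, integral_const_mul, Complex.real_smul,
    Complex.ofReal_inv]
  simp_rw [hchar t ht.le]

/-- The rescaled marginal laws of a Lévy process converge to the Lévy measure, tested against
bounded continuous functions vanishing near the origin. -/
theorem tendsto_inv_mul_integral_of_charFun_eq_exp_levyExponent [SFinite ν]
    (hAsym : ∀ x y, ⟪A x, y⟫ = ⟪x, A y⟫) (hApos : ∀ x, 0 ≤ ⟪x, A x⟫)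
    (hν : Integrable (fun y ↦ min 1 (‖y‖ ^ 2)) ν)
    (hp : ∀ t, 0 ≤ t → IsProbabilityMeasure (p t))
    (hchar : ∀ t, 0 ≤ t → ∀ ξ,
      charFun (p t) ξ = Complex.exp (-(t : ℂ) * levyExponent A γ ν ξ))
    (f : BoundedContinuousFunction E ℝ) {δ : ℝ} (hδ : 0 < δ) (hf : ∀ x, ‖x‖ < δ → f x = 0) :
    Tendsto (fun t : ℝ ↦ t⁻¹ * ∫ x, f x ∂(p t)) (𝓝[>] 0) (𝓝 (∫ x, f x ∂ν)) := by
  let m : ℝ := 1 - Real.exp (-δ ^ 2 / 2)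
  have hm : 0 < m := by
    simp only [m, sub_pos, Real.exp_lt_one_iff]
    nlinarith [pow_pos hδ 2]
  let w : E → ℝ := fun x ↦ max m (1 - Real.exp (-‖x‖ ^ 2 / 2))
  have hw : ∀ x, m ≤ w x := fun x ↦ le_max_left _ _
  have hfw : ∀ x, (1 - Real.exp (-‖x‖ ^ 2 / 2)) • (f x / w x) = f x := fun x ↦ by
    rcases lt_or_ge ‖x‖ δ with hx | hx
    · simp [hf x hx]
    · have : w x = 1 - Real.exp (-‖x‖ ^ 2 / 2) := by
        refine max_eq_right (sub_le_sub_left (Real.exp_le_exp.2 ?_) _)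
        nlinarith [pow_le_pow_left₀ hδ.le hx 2]
      rw [← this, smul_eq_mul, mul_div_cancel₀ _ (hm.trans_le (hw x)).ne']
  have hwc : Continuous w := by fun_prop
  let F : BoundedContinuousFunction E ℝ := BoundedContinuousFunction.ofNormedAddCommGroup
    (fun x ↦ f x / w x) (f.continuous.div hwc fun x ↦ (hm.trans_le (hw x)).ne') (‖f‖ / m)
    fun x ↦ by
      rw [norm_div, Real.norm_of_nonneg (hm.le.trans (hw x))]
      exact div_le_div₀ (norm_nonneg f) (f.norm_coe_le_norm x) hm (hw x)
  have hF : ∀ μ : Measure E, ∫ x, F x ∂(gaussianDamped μ) = ∫ x, f x ∂μ := fun μ ↦ by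
    rw [integral_gaussianDamped]
    exact integral_congr_ae (ae_of_all _ hfw)
  have hF0 : F 0 = 0 := by simp [F, hf 0 (by simpa using hδ)]
  have := isFiniteMeasure_gaussianDamped hν
  have hlim : Tendsto (fun t : ℝ ↦ ∫ x, F x ∂(ENNReal.ofReal t⁻¹ • gaussianDamped (p t))) (𝓝[>] 0)
      (𝓝 (∫ x, F x ∂(gaussianDamped ν
        + ENNReal.ofReal (∫ η, ⟪η, A η⟫ ∂(stdGaussian E)) • Measure.dirac 0))) := by
    refine tendsto_of_seq_tendsto fun u hu ↦ ?_
    have hu0 : ∀ᶠ n in atTop, 0 < u n := hu.eventually self_mem_nhdsWithin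
    obtain ⟨N, hN⟩ := eventually_atTop.1 hu0
    have hfin : ∀ n, IsFiniteMeasure
        (ENNReal.ofReal (u (n + N))⁻¹ • gaussianDamped (p (u (n + N)))) := fun n ↦ by
      have := hp _ (hN (n + N) (Nat.le_add_left _ _)).le
      have := isFiniteMeasure_gaussianDamped
        (integrable_min_one_sq_of_isFiniteMeasure (p (u (n + N))))
      exact Measure.smul_finite _ ENNReal.ofReal_ne_top
    have := Measure.smul_finite (Measure.dirac (0 : E))
      (ENNReal.ofReal_ne_top (r := ∫ η, ⟪η, A η⟫ ∂(stdGaussian E)))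
    refine (tendsto_add_atTop_iff_nat N).1 (tendsto_integral_of_tendsto_charFun (μ := fun n ↦
      ENNReal.ofReal (u (n + N))⁻¹ • gaussianDamped (p (u (n + N)))) (fun ξ ↦ ?_) F)
    exact (tendsto_charFun_inv_smul_gaussianDamped hAsym hApos hν hp hchar ξ).comp
      (hu.comp (tendsto_add_atTop_nat N))
  have hlim_eq : ∫ x, F x ∂(gaussianDamped ν
      + ENNReal.ofReal (∫ η, ⟪η, A η⟫ ∂(stdGaussian E)) • Measure.dirac 0) = ∫ x, f x ∂ν := by
    rw [integral_add_measure (F.integrable _)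
      ((F.integrable _).smul_measure ENNReal.ofReal_ne_top), integral_smul_measure, integral_dirac,
      hF0, smul_zero, add_zero, hF]
  rw [hlim_eq] at hlim
  refine hlim.congr' ?_
  filter_upwards [self_mem_nhdsWithin] with t ht
  have ht : 0 < t := ht
  rw [integral_smul_measure, hF, ENNReal.toReal_ofReal (inv_nonneg.2 ht.le), smul_eq_mul]

end SmallTime

section Overlap

variable {G : Type*} [AddGroup G] [MeasurableSpace G]

theorem continuous_measureReal_inter_sub_mem [TopologicalSpace G] [IsTopologicalAddGroup G]
    [BorelSpace G] {μ : Measure G} [μ.IsAddRightInvariant]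
    [μ.InnerRegularCompactLTTop] [IsLocallyFiniteMeasure μ] {s t : Set G} (hs : MeasurableSet s)
    (ht : MeasurableSet t) (htμ : μ t ≠ ⊤) :
    Continuous fun x ↦ μ.real (s ∩ {y | y - x ∈ t}) := by
  have hpres : ∀ x, MeasurePreserving (fun y ↦ y - x) μ μ := measurePreserving_sub_right μ
  have hmeas : ∀ x, MeasurableSet {y | y - x ∈ t} := fun x ↦ (hpres x).measurable ht
  have hfin : ∀ x, μ {y | y - x ∈ t} ≠ ⊤ := fun x ↦ by
    have := (hpres x).measure_preimage ht.nullMeasurableSet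
    exact this ▸ htμ
  have hcont : Continuous fun x ↦ (⟨fun y ↦ y - x, by fun_prop⟩ : C(G, G)) :=
    ContinuousMap.continuous_of_continuous_uncurry _ (continuous_snd.sub continuous_fst)
  refine continuous_iff_continuousAt.2 fun a ↦ tendsto_iff_dist_tendsto_zero.2 ?_
  have hlim := tendsto_measure_symmDiff_preimage_nhds_zero (μ := μ) (ν := μ) (hcont.tendsto a)
    (Eventually.of_forall hpres) (hpres a) ht.nullMeasurableSet htμ
  have hlim' := (ENNReal.tendsto_toReal ENNReal.zero_ne_top).comp hlim
  refine squeeze_zero (fun _ ↦ dist_nonneg) (fun x ↦ ?_) hlim'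
  rw [Real.dist_eq]
  refine (abs_measureReal_sub_le_measureReal_symmDiff' (hs.inter (hmeas x)).nullMeasurableSet
    (hs.inter (hmeas a)).nullMeasurableSet (measure_ne_top_of_subset Set.inter_subset_right (hfin x))
    (measure_ne_top_of_subset Set.inter_subset_right (hfin a))).trans ?_
  refine ENNReal.toReal_mono ?_ (measure_mono ?_)
  · refine measure_ne_top_of_subset (symmDiff_le_sup (a := {y | y - x ∈ t})) ?_
    exact (measure_union_lt_top (hfin x).lt_top (hfin a).lt_top).ne
  · rw [← Set.inter_symmDiff_distrib_left]
    exact Set.inter_subset_right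

theorem integral_measureReal_inter_sub_mem [MeasurableSub₂ G] {μ ν : Measure G} [SFinite μ]
    [SFinite ν] {s t : Set G} (hs : MeasurableSet s) (ht : MeasurableSet t) (hsμ : μ s ≠ ⊤)
    (hν : ∀ y ∈ s, ν {w | y - w ∈ t} ≠ ⊤) :
    ∫ x, μ.real (s ∩ {y | y - x ∈ t}) ∂ν = ∫ y in s, ν.real {w | y - w ∈ t} ∂μ := by
  have hP : MeasurableSet {p : G × G | p.2 - p.1 ∈ t} := (measurable_snd.sub measurable_fst) ht
  have hleft : ∀ x, μ (s ∩ {y | y - x ∈ t})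
      = μ.restrict s (Prod.mk x ⁻¹' {p : G × G | p.2 - p.1 ∈ t}) := fun x ↦ by
    rw [Measure.restrict_apply (measurable_prodMk_left hP), Set.inter_comm]
    rfl
  have hfubini := (Measure.prod_apply (μ := ν) (ν := μ.restrict s) hP).symm.trans
    (Measure.prod_apply_symm hP)
  simp only [← hleft] at hfubini
  simp only [Measure.real]
  rw [integral_toReal, integral_toReal, hfubini]
  · rfl
  · exact (measurable_measure_prodMk_right hP).aemeasurable
  · exact (ae_restrict_iff' hs).2 (ae_of_all _ fun y hy ↦ (hν y hy).lt_top)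
  · simp only [hleft]
    exact (measurable_measure_prodMk_left hP).aemeasurable
  · exact ae_of_all _ fun x ↦ (measure_mono Set.inter_subset_left).trans_lt hsμ.lt_top

end Overlap

/-- Example 2, Case 1: for a Lévy process with triplet (A, γ, ν) and open sets
Ω, Ω₀ of finite volume at positive distance D from each other, with
r(x) = |Ω ∩ (Ω₀ + x)| one has t⁻¹ ∫ r dp_t → ∫_Ω ν(y − Ω₀) dy as t → 0+. -/
theorem heat_content_disjoint_sets
    (d : ℕ) (hd : 1 ≤ d)
    -- generating triplet (A, γ, ν)
    (A : EuclideanSpace ℝ (Fin d) →L[ℝ] EuclideanSpace ℝ (Fin d))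
    (hAsym : ∀ x y, ⟪A x, y⟫ = ⟪x, A y⟫) (hApos : ∀ x, 0 ≤ ⟪x, A x⟫)
    (γ : EuclideanSpace ℝ (Fin d))
    (ν : Measure (EuclideanSpace ℝ (Fin d)))
    (hν0 : ν {0} = 0)
    (hνlevy : ∫⁻ y, ENNReal.ofReal (min 1 (‖y‖ ^ 2)) ∂ν < ⊤)
    -- the characteristic exponent
    (ψ : EuclideanSpace ℝ (Fin d) → ℂ)
    (hψ : ∀ ξ, ψ ξ = (⟪ξ, A ξ⟫ : ℂ) - Complex.I * (⟪ξ, γ⟫ : ℂ)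
      - ∫ y, (Complex.exp (Complex.I * (⟪ξ, y⟫ : ℂ)) - 1
          - Complex.I * (if ‖y‖ ≤ 1 then (⟪ξ, y⟫ : ℂ) else 0)) ∂ν)
    -- (p t) are the marginal laws of the process
    (p : ℝ → Measure (EuclideanSpace ℝ (Fin d)))
    (hp : ∀ t, 0 ≤ t → IsProbabilityMeasure (p t))
    (hchar : ∀ t, 0 ≤ t → ∀ ξ,
      ∫ x, Complex.exp (Complex.I * (⟪ξ, x⟫ : ℂ)) ∂(p t)
        = Complex.exp (-(t : ℂ) * ψ ξ))
    -- Ω, Ω₀ are open sets of finite volume at distance D > 0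
    (Ω Ω₀ : Set (EuclideanSpace ℝ (Fin d)))
    (hΩopen : IsOpen Ω) (hΩfin : volume Ω < ⊤)
    (hΩ₀open : IsOpen Ω₀) (hΩ₀fin : volume Ω₀ < ⊤)
    (D : ℝ) (hD : 0 < D)
    (hdist : ∀ a ∈ Ω, ∀ b ∈ Ω₀, D ≤ dist a b)
    -- r(x) = |Ω ∩ (Ω₀ + x)|
    (r : EuclideanSpace ℝ (Fin d) → ℝ)
    (hr : ∀ x, r x = (volume (Ω ∩ {y | y - x ∈ Ω₀})).toReal) :
    Tendsto (fun t : ℝ => t⁻¹ * ∫ x, r x ∂(p t)) (𝓝[>] 0)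
      (𝓝 (∫ y in Ω, (ν {w | y - w ∈ Ω₀}).toReal)) := by
  have hlevy := integrable_min_one_sq hνlevy
  have := sigmaFinite_of_integrable_min_one_sq hν0 hlevy
  have hψ' : ψ = levyExponent A γ ν := funext hψ
  have hr' : r = fun x ↦ volume.real (Ω ∩ {y | y - x ∈ Ω₀}) := funext hr
  have hrcont : Continuous r := by
    rw [hr']
    exact continuous_measureReal_inter_sub_mem hΩopen.measurableSet hΩ₀open.measurableSet
      hΩ₀fin.ne
  have hrbound : ∀ x, ‖r x‖ ≤ volume.real Ω := fun x ↦ by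
    rw [hr', Real.norm_of_nonneg measureReal_nonneg]
    exact measureReal_mono Set.inter_subset_left hΩfin.ne
  have hrzero : ∀ x, ‖x‖ < D → r x = 0 := fun x hx ↦ by
    have : Ω ∩ {y | y - x ∈ Ω₀} = ∅ := by
      refine Set.eq_empty_of_forall_notMem fun y hy ↦ ?_
      have := hdist y hy.1 (y - x) hy.2
      rw [dist_self_sub_right] at this
      linarith
    rw [hr, this, measure_empty, ENNReal.toReal_zero]
  have hνfin : ∀ y ∈ Ω, ν {w | y - w ∈ Ω₀} ≠ ⊤ := fun y hy ↦ by
    refine ((measure_mono fun w hw ↦ ?_).trans_lt (measure_lt_top_of_le_norm hlevy hD)).ne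
    simpa using hdist y hy (y - w) hw
  have hlim := tendsto_inv_mul_integral_of_charFun_eq_exp_levyExponent hAsym hApos hlevy hp
    (fun t ht ξ ↦ by rw [charFun_eq_integral_exp_I_mul, hchar t ht, hψ'])
    (BoundedContinuousFunction.ofNormedAddCommGroup r hrcont _ hrbound) hD hrzero
  simp only [BoundedContinuousFunction.coe_ofNormedAddCommGroup] at hlim
  convert hlim using 2
  rw [hr']
  exact (integral_measureReal_inter_sub_mem hΩopen.measurableSet hΩ₀open.measurableSet
    hΩfin.ne hνfin).symm
end

section
/- Let d ≥ 2, let f : (0,∞) → (0,∞) be regularly varying at infinity of index α ∈ (0, 2) with ∫_0^∞ min(1, r²) f(1/r) r^{−1} dr < ∞, and let m be a finite nonzero Borel measure on the unit sphere S^{d−1} that is not supported on any linear hyperplane (i.e. for every v ≠ 0, m({θ ∈ S^{d−1} : ⟨v,θ⟩ ≠ 0}) > 0). Define ψ(x) = ∫_{S^{d−1}} ∫_0^∞ (1 − cos⟨x, rθ⟩) f(1/r) r^{−1} dr m(dθ). Then there exist s₀ ≥ 1 and constants c, C > 0 such that for every θ₀ ∈ S^{d−1} and every s ≥ s₀, c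 · f(s) ≤ ψ(s θ₀) ≤ C · f(s); in particular sup_{θ∈S^{d−1}, 0<u≤s} ψ(uθ) ≍ f(s) for s ≥ s₀. -/
open MeasureTheory Filter Metric
open scoped Topology RealInnerProductSpace ENNReal

/-- Uniform boundedness of the increments of a slowly varying function, in additive form. -/
lemma exists_forall_abs_add_sub_le {k : ℝ → ℝ} (hk : Measurable k)
    (hlim : ∀ u : ℝ, Tendsto (fun x => k (x + u) - k x) atTop (𝓝 0)) :
    ∃ x₀ : ℝ, ∀ x, x₀ ≤ x → ∀ t ∈ Set.Icc (0 : ℝ) 1, |k (x + t) - k x| ≤ 2 := by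
  set g : ℝ → ℝ → ℝ := fun x u => min 1 |k (x + u) - k x| with hg
  have hgm : ∀ x, Measurable (g x) := fun x => by
    have : Measurable fun u => k (x + u) := hk.comp (measurable_const_add x)
    fun_prop
  have hg0 : ∀ x u, 0 ≤ g x u := fun x u => le_min zero_le_one (abs_nonneg _)
  have hg1 : ∀ x u, g x u ≤ 1 := fun x u => min_le_left _ _
  have hgi : ∀ x a b, IntervalIntegrable (g x) volume a b := fun x a b =>
    (intervalIntegrable_const (c := (1 : ℝ))).mono_fun (hgm x).aestronglyMeasurable
      (Eventually.of_forall fun u => by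
        simpa [abs_of_nonneg (hg0 x u)] using hg1 x u)
  have hconv : Tendsto (fun x => ∫ u in (0 : ℝ)..2, g x u) atTop (𝓝 0) := by
    have h := intervalIntegral.tendsto_integral_filter_of_dominated_convergence
      (μ := volume) (a := (0 : ℝ)) (b := 2) (l := (atTop : Filter ℝ)) (F := g)
      (f := fun _ => (0 : ℝ)) (fun _ => (1 : ℝ))
      (Eventually.of_forall fun x => (hgm x).aestronglyMeasurable)
      (Eventually.of_forall fun x => Eventually.of_forall fun u _ => by
        simpa [abs_of_nonneg (hg0 x u)] using hg1 x u)
      intervalIntegrable_const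
      (Eventually.of_forall fun u _ => by
        simpa [hg] using (tendsto_const_nhds (x := (1 : ℝ))).min (hlim u).abs)
    simpa using h
  obtain ⟨x₀, hx₀⟩ := eventually_atTop.1 (hconv.eventually (gt_mem_nhds (show (0 : ℝ) < 1 / 2 by norm_num)))
  refine ⟨x₀, fun x hx t ht => ?_⟩
  obtain ⟨u, hu1, hu2⟩ : ∃ u, g x u < 1 ∧ g (x + t) (u - t) < 1 := by
    by_contra! hcon
    have h1 : ∀ u, 1 ≤ g x u + g (x + t) (u - t) := fun u => by
      by_cases h : g x u < 1
      · linarith [hcon u h, hg0 x u]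
      · linarith [hg0 (x + t) (u - t)]
    have hi2 : IntervalIntegrable (fun u => g (x + t) (u - t)) volume 1 2 :=
      (intervalIntegrable_const (c := (1 : ℝ))).mono_fun
        ((hgm (x + t)).comp (measurable_sub_const t)).aestronglyMeasurable
        (Eventually.of_forall fun u => by
          simpa [abs_of_nonneg (hg0 (x + t) (u - t))] using hg1 (x + t) (u - t))
    have h2 : (1 : ℝ) ≤ (∫ u in (1 : ℝ)..2, g x u) + ∫ u in (1 : ℝ)..2, g (x + t) (u - t) := by
      rw [← intervalIntegral.integral_add (hgi x 1 2) hi2]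
      calc (1 : ℝ) = ∫ u in (1 : ℝ)..2, (1 : ℝ) := by norm_num
        _ ≤ _ := intervalIntegral.integral_mono_on (by norm_num) intervalIntegrable_const
            ((hgi x 1 2).add hi2) fun u _ => h1 u
    rw [intervalIntegral.integral_comp_sub_right] at h2
    have hsub : ∀ y a b, 0 ≤ a → a ≤ b → b ≤ 2 →
        ∫ u in a..b, g y u ≤ ∫ u in (0 : ℝ)..2, g y u := fun y a b ha hab hb =>
      intervalIntegral.integral_mono_interval ha hab hb
        (Eventually.of_forall fun u => hg0 y u) (hgi y 0 2)
    have h3 := hsub x 1 2 (by norm_num) (by norm_num) le_rfl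
    have h4 := hsub (x + t) (1 - t) (2 - t) (by linarith [ht.2]) (by linarith) (by linarith [ht.1])
    linarith [hx₀ x hx, hx₀ (x + t) (by linarith [ht.1])]
  have e1 : |k (x + u) - k x| < 1 := by simpa [hg] using hu1
  have e2 : |k (x + u) - k (x + t)| < 1 := by simpa [hg] using hu2
  rw [abs_lt] at e1 e2
  rw [abs_le]
  constructor <;> linarith [e1.1, e1.2, e2.1, e2.2]

/-- Potter-type bound in additive form. -/
lemma exists_forall_abs_sub_le_mul_add {k : ℝ → ℝ} (hk : Measurable k)
    (hlim : ∀ u : ℝ, Tendsto (fun x => k (x + u) - k x) atTop (𝓝 0)) {δ : ℝ} (hδ : 0 < δ) :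
    ∃ x₀ : ℝ, ∀ x, x₀ ≤ x → ∀ t, 0 ≤ t → |k (x + t) - k x| ≤ δ * t + 2 := by
  obtain ⟨x₁, hx₁⟩ := exists_forall_abs_add_sub_le hk hlim
  obtain ⟨x₂, hx₂⟩ := eventually_atTop.1
    ((hlim 1).abs.eventually (gt_mem_nhds (show |(0 : ℝ)| < δ by simpa using hδ)))
  refine ⟨max x₁ x₂, fun x hx t ht => ?_⟩
  have hstep : ∀ n : ℕ, |k (x + n) - k x| ≤ δ * n := by
    intro n
    induction n with
    | zero => simp
    | succ n ih =>
      have h := hx₂ (x + n) (by linarith [le_max_right x₁ x₂, n.cast_nonneg (α := ℝ)])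
      have h' := abs_add_le (k (x + n + 1) - k (x + n)) (k (x + n) - k x)
      push_cast
      rw [← add_assoc]
      rw [sub_add_sub_cancel] at h'
      linarith
  have hfl := Nat.floor_le ht
  have hfl' := (Nat.lt_floor_add_one t).le
  have h1 := hx₁ (x + ⌊t⌋₊) (by linarith [le_max_left x₁ x₂, ⌊t⌋₊.cast_nonneg (α := ℝ)])
    (t - ⌊t⌋₊) ⟨by linarith, by linarith⟩
  have h2 := hstep ⌊t⌋₊
  have h3 := abs_add_le (k (x + t) - k (x + ⌊t⌋₊)) (k (x + ⌊t⌋₊) - k x)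
  rw [sub_add_sub_cancel] at h3
  rw [add_assoc, add_sub_cancel] at h1
  linarith [mul_le_mul_of_nonneg_left hfl hδ.le]

/-- Potter bounds for a measurable regularly varying function. -/
lemma exists_potter_bound {α : ℝ} {f : ℝ → ℝ} (hfmeas : Measurable f)
    (hfpos : ∀ s : ℝ, 0 < s → 0 < f s)
    (hfreg : ∀ l : ℝ, 0 < l → Tendsto (fun s => f (l * s) / f s) atTop (𝓝 (l ^ α)))
    {δ : ℝ} (hδ : 0 < δ) :
    ∃ s₀ : ℝ, 1 ≤ s₀ ∧ ∃ K : ℝ, 0 < K ∧ ∀ s, s₀ ≤ s → ∀ l, 1 ≤ l →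
      f (l * s) ≤ K * l ^ (α + δ) * f s ∧ l ^ (α - δ) * f s ≤ K * f (l * s) := by
  set k : ℝ → ℝ := fun x => Real.log (f (Real.exp x)) - α * x with hkdef
  have hk : Measurable k := by fun_prop
  have hlim : ∀ u : ℝ, Tendsto (fun x => k (x + u) - k x) atTop (𝓝 0) := by
    intro u
    have h1 := (hfreg (Real.exp u) (Real.exp_pos u)).comp Real.tendsto_exp_atTop
    have h2 := (h1.log (Real.rpow_pos_of_pos (Real.exp_pos u) α).ne').sub_const (α * u)
    rw [Real.log_rpow (Real.exp_pos u), Real.log_exp, sub_self] at h2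
    refine h2.congr fun x => ?_
    have hx := hfpos _ (Real.exp_pos x)
    have hxu := hfpos _ (mul_pos (Real.exp_pos u) (Real.exp_pos x))
    simp only [hkdef, Function.comp_apply]
    rw [Real.log_div hxu.ne' hx.ne', Real.exp_add, mul_comm (Real.exp x)]
    ring
  obtain ⟨x₀, hx₀⟩ := exists_forall_abs_sub_le_mul_add hk hlim hδ
  refine ⟨max 1 (Real.exp x₀), le_max_left _ _, Real.exp 2, Real.exp_pos _, fun s hs l hl => ?_⟩
  have hs0 : 0 < s := lt_of_lt_of_le one_pos ((le_max_left _ _).trans hs)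
  have hl0 : 0 < l := one_pos.trans_le hl
  have h := hx₀ (Real.log s) ((Real.le_log_iff_exp_le hs0).2 ((le_max_right _ _).trans hs))
    (Real.log l) (Real.log_nonneg hl)
  simp only [hkdef] at h
  rw [Real.exp_add, Real.exp_log hs0, Real.exp_log hl0, mul_comm s, abs_le] at h
  have hfs := hfpos s hs0
  have hfl := hfpos (l * s) (mul_pos hl0 hs0)
  constructor
  · rw [← Real.log_le_log_iff hfl (by positivity), Real.log_mul (by positivity) hfs.ne',
      Real.log_mul (by positivity) (by positivity), Real.log_exp, Real.log_rpow hl0]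
    linarith [h.2]
  · rw [← Real.log_le_log_iff (by positivity) (by positivity), Real.log_mul (by positivity) hfs.ne',
      Real.log_mul (by positivity) hfl.ne', Real.log_exp, Real.log_rpow hl0]
    linarith [h.1]

/-- Integrability of the truncated radial profile at every scale. -/
lemma integrableOn_min_one_sq_mul {f : ℝ → ℝ} (hfmeas : Measurable f)
    (hfpos : ∀ s : ℝ, 0 < s → 0 < f s)
    (hfint : ∫⁻ u in Set.Ioi (0 : ℝ), ENNReal.ofReal (min 1 (u ^ 2) * f (1 / u) / u) < ⊤)
    (s : ℝ) :
    IntegrableOn (fun u => min 1 ((s * u) ^ 2) * f (1 / u) / u) (Set.Ioi 0) := by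
  have hF : ∀ s : ℝ, Measurable fun u : ℝ => min 1 ((s * u) ^ 2) * f (1 / u) / u := fun s => by
    have : Measurable fun u : ℝ => f (1 / u) := hfmeas.comp (measurable_const.div measurable_id)
    fun_prop
  have h1 : IntegrableOn (fun u => min 1 (u ^ 2) * f (1 / u) / u) (Set.Ioi 0) := by
    refine ⟨by simpa using (hF 1).aestronglyMeasurable, ?_⟩
    rw [hasFiniteIntegral_iff_ofReal]
    · exact hfint
    · refine (ae_restrict_mem measurableSet_Ioi).mono fun u (hu : 0 < u) => ?_
      have := hfpos (1 / u) (by positivity)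
      simp only [Pi.zero_apply]
      positivity
  refine (h1.const_mul (max 1 (s ^ 2))).mono' (hF s).aestronglyMeasurable ?_
  refine (ae_restrict_mem measurableSet_Ioi).mono fun u (hu : 0 < u) => ?_
  have hfu := hfpos (1 / u) (by positivity)
  rw [Real.norm_of_nonneg (by positivity), mul_div_assoc, mul_div_assoc, ← mul_assoc]
  refine mul_le_mul_of_nonneg_right ?_ (by positivity)
  rw [mul_pow]
  rcases le_total 1 (u ^ 2) with h | h
  · rw [min_eq_left h, mul_one]
    exact (min_le_left _ _).trans (le_max_left _ _)
  · rw [min_eq_right h]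
    exact (min_le_right _ _).trans (mul_le_mul_of_nonneg_right (le_max_right _ _) (sq_nonneg u))

/-- Karamata-type upper bound for the truncated second moment of the radial profile. -/
lemma exists_integral_min_one_sq_mul_le {α : ℝ} {f : ℝ → ℝ}
    (hfmeas : Measurable f) (hfpos : ∀ s : ℝ, 0 < s → 0 < f s)
    (hfint : ∫⁻ u in Set.Ioi (0 : ℝ), ENNReal.ofReal (min 1 (u ^ 2) * f (1 / u) / u) < ⊤)
    {δ s₀ K : ℝ} (hγ : 0 < α - δ) (hβ : α + δ < 2) (hs₀ : 1 ≤ s₀) (hK : 0 < K)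
    (hpot : ∀ s, s₀ ≤ s → ∀ l, 1 ≤ l →
      f (l * s) ≤ K * l ^ (α + δ) * f s ∧ l ^ (α - δ) * f s ≤ K * f (l * s)) :
    ∃ C : ℝ, 0 < C ∧ ∀ s, s₀ ≤ s →
      ∫ u in Set.Ioi (0 : ℝ), min 1 ((s * u) ^ 2) * f (1 / u) / u ≤ C * f s := by
  have hFi := integrableOn_min_one_sq_mul hfmeas hfpos hfint
  have hF0 : ∀ s u : ℝ, 0 < u → 0 ≤ min 1 ((s * u) ^ 2) * f (1 / u) / u := fun s u hu => by
    have := hfpos (1 / u) (by positivity)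
    positivity
  set J := ∫ u in Set.Ioi (0 : ℝ), min 1 ((1 * u) ^ 2) * f (1 / u) / u with hJ
  have hJ0 : 0 ≤ J := setIntegral_nonneg measurableSet_Ioi fun u hu => hF0 1 u hu
  have hfs₀ := hfpos s₀ (by linarith)
  generalize hβd : α + δ = β at *
  generalize hγd : α - δ = γ at *
  have hβ' : 0 < 2 - β := by linarith
  refine ⟨K / (2 - β) + (K / γ + s₀ ^ 2 * J * (K / f s₀)), by positivity, fun s hs => ?_⟩
  have hs0 : 0 < s := by linarith
  have hfs := hfpos s hs0
  have hi : 0 < 1 / s := by positivity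
  rw [← Set.Ioc_union_Ioi_eq_Ioi hi.le, setIntegral_union (Set.Ioc_disjoint_Ioi le_rfl)
    measurableSet_Ioi ((hFi s).mono_set Set.Ioc_subset_Ioi_self)
    ((hFi s).mono_set (Set.Ioi_subset_Ioi hi.le)), add_mul]
  refine add_le_add ?_ ?_
  · have hint : IntegrableOn (fun u : ℝ => K * f s * s ^ (2 - β) * u ^ (1 - β))
        (Set.Ioc 0 (1 / s)) :=
      ((intervalIntegrable_iff_integrableOn_Ioc_of_le hi.le).1
        (intervalIntegral.intervalIntegrable_rpow' (by linarith))).const_mul _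
    refine (setIntegral_mono_on ((hFi s).mono_set Set.Ioc_subset_Ioi_self) hint
      measurableSet_Ioc ?_).trans (le_of_eq ?_)
    · rintro u ⟨hu, hus⟩
      have hsu : 0 < s * u := by positivity
      have hle : s * u ≤ 1 := by rwa [le_div_iff₀ hs0, mul_comm] at hus
      have h := (hpot s hs (1 / (s * u)) (by rwa [one_le_div hsu])).1
      have e : 1 / (s * u) * s = 1 / u := by field_simp
      rw [e] at h
      calc min 1 ((s * u) ^ 2) * f (1 / u) / u
          ≤ (s * u) ^ 2 * (K * (1 / (s * u)) ^ β * f s) / u := by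
            gcongr
            · exact (hfpos _ (by positivity)).le
            · exact min_le_right _ _
        _ = K * f s * s ^ (2 - β) * u ^ (1 - β) := by
            rw [one_div, Real.inv_rpow hsu.le, Real.mul_rpow hs0.le hu.le, Real.rpow_sub hs0,
              Real.rpow_sub hu, Real.rpow_one, Real.rpow_two]
            field_simp
    · rw [integral_const_mul, ← intervalIntegral.integral_of_le hi.le,
        integral_rpow (Or.inl (by linarith)), show 1 - β + 1 = 2 - β by ring,
        Real.zero_rpow hβ'.ne', one_div, Real.inv_rpow hs0.le]
      have := Real.rpow_pos_of_pos hs0 (2 - β)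
      field_simp
      ring
  · have hint2 : IntegrableOn (fun u : ℝ => K * f s * s ^ (-γ) * u ^ (-γ - 1))
        (Set.Ioi (1 / s)) := (integrableOn_Ioi_rpow_of_lt (by linarith) hi).const_mul _
    have hint3 : IntegrableOn (fun u : ℝ => s₀ ^ 2 * (min 1 ((1 * u) ^ 2) * f (1 / u) / u))
        (Set.Ioi (1 / s)) := ((hFi 1).mono_set (Set.Ioi_subset_Ioi hi.le)).const_mul _
    have hmono : ∫ u in Set.Ioi (1 / s), min 1 ((s * u) ^ 2) * f (1 / u) / u ≤
        ∫ u in Set.Ioi (1 / s), (K * f s * s ^ (-γ) * u ^ (-γ - 1) +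
          s₀ ^ 2 * (min 1 ((1 * u) ^ 2) * f (1 / u) / u)) := by
      refine setIntegral_mono_on ((hFi s).mono_set (Set.Ioi_subset_Ioi hi.le)) (hint2.add hint3)
        measurableSet_Ioi fun u (hu : 1 / s < u) => ?_
      have hu0 : 0 < u := hi.trans hu
      have hfu := hfpos (1 / u) (by positivity)
      have h1 : min 1 ((s * u) ^ 2) * f (1 / u) / u ≤ f (1 / u) / u := by
        rw [mul_div_assoc]
        exact mul_le_of_le_one_left (by positivity) (min_le_left _ _)
      refine h1.trans ?_
      rcases le_total u (1 / s₀) with h | h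
      · refine le_add_of_le_of_nonneg ?_ (mul_nonneg (sq_nonneg _) (hF0 1 u hu0))
        have hsu : 1 ≤ s * u := by
          rw [div_lt_iff₀ hs0] at hu
          linarith
        have hsu0 : 0 < s * u := by positivity
        have hh := (hpot (1 / u) (by rwa [le_one_div (by linarith) hu0]) (s * u) hsu).2
        have e : s * u * (1 / u) = s := by field_simp
        rw [e, Real.mul_rpow hs0.le hu0.le] at hh
        have p1 := Real.rpow_pos_of_pos hs0 γ
        have p2 := Real.rpow_pos_of_pos hu0 γ
        rw [Real.rpow_sub hu0, Real.rpow_neg hs0.le, Real.rpow_neg hu0.le, Real.rpow_one]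
        have : K * f s * (s ^ γ)⁻¹ * ((u ^ γ)⁻¹ / u) = K * f s / (s ^ γ * u ^ γ) / u := by
          field_simp
        rw [this]
        gcongr
        rw [le_div_iff₀ (by positivity)]
        linarith
      · have hq : 0 ≤ K * f s * s ^ (-γ) * u ^ (-γ - 1) := by positivity
        refine le_add_of_nonneg_of_le hq ?_
        have h' : 1 ≤ s₀ * u := by
          rw [div_le_iff₀ (by linarith)] at h
          linarith
        rw [mul_div_assoc, ← mul_assoc, one_mul]
        refine le_mul_of_one_le_left (by positivity) ?_
        rcases le_total 1 (u ^ 2) with h2 | h2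
        · rw [min_eq_left h2]
          nlinarith
        · rw [min_eq_right h2, ← mul_pow]
          exact one_le_pow₀ h'
    refine hmono.trans ?_
    rw [integral_add hint2 hint3, integral_const_mul, integral_const_mul,
      integral_Ioi_rpow_of_lt (by linarith) hi, add_mul]
    refine add_le_add (le_of_eq ?_) ?_
    · rw [show -γ - 1 + 1 = -γ by ring, one_div, Real.inv_rpow hs0.le]
      have := Real.rpow_pos_of_pos hs0 (-γ)
      field_simp
    · have hJ' : ∫ u in Set.Ioi (1 / s), min 1 ((1 * u) ^ 2) * f (1 / u) / u ≤ J :=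
        setIntegral_mono_set (hFi 1)
          ((ae_restrict_mem measurableSet_Ioi).mono fun u hu => hF0 1 u hu)
          (Set.Ioi_subset_Ioi hi.le).eventuallyLE
      have hl : 1 ≤ s / s₀ := by rwa [one_le_div (by linarith)]
      have hh := (hpot s₀ le_rfl (s / s₀) hl).2
      rw [div_mul_cancel₀ _ (by linarith : s₀ ≠ 0)] at hh
      have h5 : f s₀ ≤ K * f s :=
        (le_mul_of_one_le_left hfs₀.le (Real.one_le_rpow hl hγ.le)).trans hh
      have h6 : 1 ≤ K / f s₀ * f s := by
        rw [div_mul_eq_mul_div, one_le_div hfs₀]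
        exact h5
      rw [mul_assoc]
      have : s₀ ^ 2 * J ≤ s₀ ^ 2 * J * (K / f s₀ * f s) :=
        le_mul_of_one_le_right (by positivity) h6
      nlinarith [mul_le_mul_of_nonneg_left hJ' (sq_nonneg s₀)]

lemma one_sub_cos_le_two_mul_min {a b : ℝ} (h : |a| ≤ b) :
    1 - Real.cos a ≤ 2 * min 1 (b ^ 2) := by
  have h1 := Real.neg_one_le_cos a
  have h2 := Real.one_sub_sq_div_two_le_cos (x := a)
  have h3 : a ^ 2 ≤ b ^ 2 := sq_le_sq' (abs_le.1 h).1 (abs_le.1 h).2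
  rcases le_total 1 (b ^ 2) with h' | h'
  · rw [min_eq_left h']; linarith
  · rw [min_eq_right h']; nlinarith [sq_nonneg a]

/-- Lower bound for the radial part of the exponent in a direction with projection `a`. -/
lemma mul_sq_le_integral_one_sub_cos_mul {f : ℝ → ℝ} (hfpos : ∀ s : ℝ, 0 < s → 0 < f s)
    {K s a : ℝ} (hK : 0 < K) (hs : 0 < s) (ha : |a| ≤ 1)
    (hpot : ∀ l, 1 ≤ l → f s ≤ K * f (l * s))
    (hint : IntegrableOn (fun u => (1 - Real.cos (s * u * a)) * f (1 / u) / u) (Set.Ioi 0)) :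
    1 / (4 * Real.pi ^ 2 * K) * f s * a ^ 2 ≤
      ∫ u in Set.Ioi (0 : ℝ), (1 - Real.cos (s * u * a)) * f (1 / u) / u := by
  have hnn : ∀ u ∈ Set.Ioi (0 : ℝ), 0 ≤ (1 - Real.cos (s * u * a)) * f (1 / u) / u :=
    fun u (hu : 0 < u) => div_nonneg (mul_nonneg (by linarith [Real.cos_le_one (s * u * a)])
      (hfpos _ (by positivity)).le) hu.le
  have hsub : Set.Ioc (1 / (2 * s)) (1 / s) ⊆ Set.Ioi 0 := fun u hu =>
    lt_trans (by positivity) hu.1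
  refine le_trans ?_ (setIntegral_mono_set hint
    ((ae_restrict_mem measurableSet_Ioi).mono hnn) hsub.eventuallyLE)
  have hfs := hfpos s hs
  have hconst : ∫ _u in Set.Ioc (1 / (2 * s)) (1 / s),
      2 / Real.pi ^ 2 * (a ^ 2 / 4) * (f s / K) * s =
      1 / (4 * Real.pi ^ 2 * K) * f s * a ^ 2 := by
    have h12 : 1 / (2 * s) ≤ 1 / s := by gcongr; linarith
    rw [← intervalIntegral.integral_of_le h12, intervalIntegral.integral_const, smul_eq_mul]
    have := Real.pi_pos
    field_simp
    ring
  rw [← hconst]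
  refine setIntegral_mono_on (integrableOn_const (by simp)) (hint.mono_set hsub)
    measurableSet_Ioc ?_
  rintro u ⟨hu1, hu2⟩
  have hu : 0 < u := lt_trans (by positivity) hu1
  have hsu : s * u ≤ 1 := by rwa [le_div_iff₀ hs, mul_comm] at hu2
  have hsu0 : 0 < s * u := by positivity
  have hsu2 : 1 / 2 ≤ s * u := by
    rw [div_lt_iff₀ (by positivity)] at hu1
    linarith
  have hle : |s * u * a| ≤ Real.pi := by
    rw [abs_mul, abs_of_pos hsu0]
    nlinarith [abs_nonneg a, Real.pi_gt_three]
  have hcos := Real.cos_le_one_sub_mul_cos_sq hle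
  have hf : f s / K ≤ f (1 / u) := by
    have h := hpot (1 / (s * u)) (by rwa [one_le_div hsu0])
    rw [show 1 / (s * u) * s = 1 / u by field_simp] at h
    rw [div_le_iff₀ hK]
    linarith
  have hsu' : s ≤ 1 / u := by rwa [le_div_iff₀ hu]
  rw [div_eq_mul_one_div _ u]
  have hsq : a ^ 2 / 4 ≤ (s * u * a) ^ 2 := by
    have : (1 / 2) ^ 2 ≤ (s * u) ^ 2 := by gcongr
    rw [mul_pow]
    nlinarith [sq_nonneg a]
  have hc : 2 / Real.pi ^ 2 * (a ^ 2 / 4) ≤ 1 - Real.cos (s * u * a) := by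
    have := mul_le_mul_of_nonneg_left hsq (show 0 ≤ 2 / Real.pi ^ 2 by positivity)
    linarith
  have h0 : 0 ≤ 1 - Real.cos (s * u * a) := le_trans (by positivity) hc
  have hfu := hfpos (1 / u) (by positivity)
  have : 0 ≤ (1 - Real.cos (s * u * a)) * f (1 / u) := by positivity
  gcongr

/-- The second moment of a measure not supported on a hyperplane is nondegenerate. -/
lemma exists_pos_le_integral_inner_sq {E : Type*} [NormedAddCommGroup E] [InnerProductSpace ℝ E]
    [FiniteDimensional ℝ E] [Nontrivial E] [MeasurableSpace E] [BorelSpace E]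
    (m : Measure (sphere (0 : E) 1)) [IsFiniteMeasure m]
    (hmhyp : ∀ v : E, v ≠ 0 → 0 < m {θ : sphere (0 : E) 1 | ⟪v, (θ : E)⟫ ≠ 0}) :
    ∃ q : ℝ, 0 < q ∧ ∀ v : E, ‖v‖ = 1 → q ≤ ∫ θ : sphere (0 : E) 1, ⟪v, (θ : E)⟫ ^ 2 ∂m := by
  have hcont : Continuous fun v : E => ∫ θ : sphere (0 : E) 1, ⟪v, (θ : E)⟫ ^ 2 ∂m := by
    have := continuous_parametric_integral_of_continuous (μ := m) (s := Set.univ)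
      (f := fun (v : E) (θ : sphere (0 : E) 1) => ⟪v, (θ : E)⟫ ^ 2)
      (by fun_prop) isCompact_univ
    simpa using this
  obtain ⟨v₀, hv₀, hmin⟩ := (isCompact_sphere (0 : E) 1).exists_isMinOn
    (NormedSpace.sphere_nonempty.2 zero_le_one) hcont.continuousOn
  refine ⟨_, ?_, fun v hv => hmin (by simpa using hv)⟩
  have hv₀' : v₀ ≠ 0 := ne_zero_of_mem_unit_sphere ⟨v₀, hv₀⟩
  have hc : Continuous fun θ : sphere (0 : E) 1 => ⟪v₀, (θ : E)⟫ ^ 2 := by fun_prop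
  rw [integral_pos_iff_support_of_nonneg (fun θ => sq_nonneg _)
    (hc.integrable_of_hasCompactSupport (HasCompactSupport.of_compactSpace _))]
  convert hmhyp v₀ hv₀' using 2
  ext θ
  simp

/-- Example 4: for a symmetric Lévy exponent built from a regularly varying
radial profile f ∈ R_α (α ∈ (0,2)) and a finite spherical measure m not
supported on a hyperplane, ψ(sθ₀) ≍ f(s) uniformly in θ₀ ∈ S^{d−1} for s large;
in particular sup_{θ, u ≤ s} ψ(uθ) ≍ f(s). -/
theorem example_exponent_comparable
    (d : ℕ) (hd : 2 ≤ d)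
    -- f is regularly varying at infinity of index α ∈ (0, 2)
    (α : ℝ) (hα0 : 0 < α) (hα2 : α < 2)
    (f : ℝ → ℝ) (hfmeas : Measurable f) (hfpos : ∀ s : ℝ, 0 < s → 0 < f s)
    (hfreg : ∀ l : ℝ, 0 < l →
      Tendsto (fun s => f (l * s) / f s) atTop (𝓝 (l ^ α)))
    -- Lévy-measure integrability of the radial profile
    (hfint : ∫⁻ u in Set.Ioi (0 : ℝ),
      ENNReal.ofReal (min 1 (u ^ 2) * f (1 / u) / u) < ⊤)
    -- m is a finite nonzero spherical measure not supported on a hyperplane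
    (m : Measure (sphere (0 : EuclideanSpace ℝ (Fin d)) 1))
    (hm : IsFiniteMeasure m) (hmne : m ≠ 0)
    (hmhyp : ∀ v : EuclideanSpace ℝ (Fin d), v ≠ 0 →
      0 < m {θ : sphere (0 : EuclideanSpace ℝ (Fin d)) 1 |
        ⟪v, (θ : EuclideanSpace ℝ (Fin d))⟫ ≠ 0})
    -- the characteristic exponent ψ
    (ψ : EuclideanSpace ℝ (Fin d) → ℝ)
    (hψ : ∀ x, ψ x = ∫ θ : sphere (0 : EuclideanSpace ℝ (Fin d)) 1,
      (∫ u in Set.Ioi (0 : ℝ),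
        (1 - Real.cos ⟪x, u • (θ : EuclideanSpace ℝ (Fin d))⟫) * f (1 / u) / u)
        ∂m) :
    ∃ s₀ : ℝ, 1 ≤ s₀ ∧
      (∃ c > (0 : ℝ), ∃ C > (0 : ℝ),
        ∀ θ₀ : EuclideanSpace ℝ (Fin d), ‖θ₀‖ = 1 → ∀ s : ℝ, s₀ ≤ s →
          c * f s ≤ ψ (s • θ₀) ∧ ψ (s • θ₀) ≤ C * f s) ∧
      (∃ c > (0 : ℝ), ∃ C > (0 : ℝ), ∀ s : ℝ, s₀ ≤ s →
        c * f s ≤ sSup {z : ℝ | ∃ θ : EuclideanSpace ℝ (Fin d), ∃ u : ℝ,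
            ‖θ‖ = 1 ∧ 0 < u ∧ u ≤ s ∧ z = ψ (u • θ)} ∧
          sSup {z : ℝ | ∃ θ : EuclideanSpace ℝ (Fin d), ∃ u : ℝ,
            ‖θ‖ = 1 ∧ 0 < u ∧ u ≤ s ∧ z = ψ (u • θ)} ≤ C * f s) := by
  obtain ⟨δ, hδ, hγ, hβ⟩ : ∃ δ > 0, 0 < α - δ ∧ α + δ < 2 := by
    obtain ⟨δ, hδ, hlt⟩ := exists_between (lt_min hα0 (sub_pos.2 hα2))
    exact ⟨δ, hδ, by linarith [min_le_left α (2 - α)], by linarith [min_le_right α (2 - α)]⟩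
  obtain ⟨s₀, hs₀, K, hK, hpot⟩ := exists_potter_bound hfmeas hfpos hfreg hδ
  obtain ⟨C, hC, hup⟩ :=
    exists_integral_min_one_sq_mul_le hfmeas hfpos hfint hγ hβ hs₀ hK hpot
  have : Nontrivial (EuclideanSpace ℝ (Fin d)) := by
    have : Nontrivial (Fin d) := Fin.nontrivial_iff_two_le.2 hd
    infer_instance
  obtain ⟨q, hq, hqle⟩ := exists_pos_le_integral_inner_sq m hmhyp
  have hFi := integrableOn_min_one_sq_mul hfmeas hfpos hfint
  have hm0 : 0 < m.real Set.univ :=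
    ENNReal.toReal_pos (by simpa using hmne) (measure_ne_top m _)
  have hinner : ∀ θ₀ : EuclideanSpace ℝ (Fin d), ‖θ₀‖ = 1 →
      ∀ θ : sphere (0 : EuclideanSpace ℝ (Fin d)) 1,
        |⟪θ₀, (θ : EuclideanSpace ℝ (Fin d))⟫| ≤ 1 := fun θ₀ h θ => by
    have := abs_real_inner_le_norm θ₀ (θ : EuclideanSpace ℝ (Fin d))
    simpa [h] using this
  have hψ' : ∀ (θ₀ : EuclideanSpace ℝ (Fin d)) (s : ℝ), ψ (s • θ₀) =
      ∫ θ : sphere (0 : EuclideanSpace ℝ (Fin d)) 1, (∫ u in Set.Ioi (0 : ℝ),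
        (1 - Real.cos (s * u * ⟪θ₀, (θ : EuclideanSpace ℝ (Fin d))⟫)) * f (1 / u) / u) ∂m := by
    intro θ₀ s
    simp_rw [hψ, real_inner_smul_left, real_inner_smul_right, mul_assoc]
  have hfm : Measurable fun u : ℝ => f (1 / u) :=
    hfmeas.comp (measurable_const.div measurable_id)
  have hb : ∀ s a u : ℝ, 0 ≤ s → |a| ≤ 1 → 0 < u →
      0 ≤ (1 - Real.cos (s * u * a)) * f (1 / u) / u ∧
      (1 - Real.cos (s * u * a)) * f (1 / u) / u ≤
        2 * (min 1 ((s * u) ^ 2) * f (1 / u) / u) := by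
    intro s a u hs ha hu
    have hfu := hfpos (1 / u) (by positivity)
    have h0 : 0 ≤ 1 - Real.cos (s * u * a) := by linarith [Real.cos_le_one (s * u * a)]
    refine ⟨by positivity, ?_⟩
    rw [mul_div_assoc, mul_div_assoc, ← mul_assoc]
    refine mul_le_mul_of_nonneg_right (one_sub_cos_le_two_mul_min ?_) (by positivity)
    rw [abs_mul, abs_of_nonneg (by positivity)]
    exact mul_le_of_le_one_right (by positivity) ha
  have hIi : ∀ s a : ℝ, 0 ≤ s → |a| ≤ 1 →
      IntegrableOn (fun u => (1 - Real.cos (s * u * a)) * f (1 / u) / u) (Set.Ioi 0) := by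
    intro s a hs ha
    refine ((hFi s).const_mul 2).mono' (Measurable.aestronglyMeasurable (by fun_prop)) ?_
    refine (ae_restrict_mem measurableSet_Ioi).mono fun u hu => ?_
    rw [Real.norm_of_nonneg (hb s a u hs ha hu).1]
    exact (hb s a u hs ha hu).2
  have hI0 : ∀ s a : ℝ, 0 ≤ s → |a| ≤ 1 →
      0 ≤ ∫ u in Set.Ioi (0 : ℝ), (1 - Real.cos (s * u * a)) * f (1 / u) / u :=
    fun s a hs ha => setIntegral_nonneg measurableSet_Ioi fun u hu => (hb s a u hs ha hu).1
  have hIle : ∀ r s a : ℝ, 0 ≤ r → r ≤ s → s₀ ≤ s → |a| ≤ 1 →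
      ∫ u in Set.Ioi (0 : ℝ), (1 - Real.cos (r * u * a)) * f (1 / u) / u ≤ 2 * C * f s := by
    intro r s a hr hrs hs ha
    calc ∫ u in Set.Ioi (0 : ℝ), (1 - Real.cos (r * u * a)) * f (1 / u) / u
        ≤ ∫ u in Set.Ioi (0 : ℝ), 2 * (min 1 ((s * u) ^ 2) * f (1 / u) / u) := by
          refine setIntegral_mono_on (hIi r a hr ha) ((hFi s).const_mul 2) measurableSet_Ioi
            fun u (hu : 0 < u) => (hb r a u hr ha hu).2.trans ?_
          have hfu := hfpos (1 / u) (by positivity)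
          gcongr
      _ ≤ 2 * C * f s := by
          rw [integral_const_mul, mul_assoc]
          exact mul_le_mul_of_nonneg_left (hup s hs) zero_le_two
  have hupper : ∀ θ₀ : EuclideanSpace ℝ (Fin d), ‖θ₀‖ = 1 → ∀ r s : ℝ, 0 ≤ r → r ≤ s →
      s₀ ≤ s → ψ (r • θ₀) ≤ m.real Set.univ * (2 * C) * f s := by
    intro θ₀ hθ₀ r s hr hrs hs
    rw [hψ']
    refine (integral_mono_of_nonneg (Eventually.of_forall fun θ => hI0 r _ hr (hinner θ₀ hθ₀ θ))
      (integrable_const (2 * C * f s))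
      (Eventually.of_forall fun θ => hIle r s _ hr hrs hs (hinner θ₀ hθ₀ θ))).trans
      (le_of_eq ?_)
    rw [integral_const, smul_eq_mul]
    ring
  have hlower : ∀ θ₀ : EuclideanSpace ℝ (Fin d), ‖θ₀‖ = 1 → ∀ s : ℝ, s₀ ≤ s →
      1 / (4 * Real.pi ^ 2 * K) * q * f s ≤ ψ (s • θ₀) := by
    intro θ₀ hθ₀ s hs
    have hs0 : 0 < s := by linarith
    have hfs := hfpos s hs0
    rw [hψ']
    have hmeas : AEStronglyMeasurable (fun θ : sphere (0 : EuclideanSpace ℝ (Fin d)) 1 =>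
        ∫ u in Set.Ioi (0 : ℝ),
          (1 - Real.cos (s * u * ⟪θ₀, (θ : EuclideanSpace ℝ (Fin d))⟫)) * f (1 / u) / u) m := by
      refine (StronglyMeasurable.integral_prod_right (Measurable.stronglyMeasurable ?_)
        ).aestronglyMeasurable
      have : Measurable fun p : sphere (0 : EuclideanSpace ℝ (Fin d)) 1 × ℝ => f (1 / p.2) :=
        hfm.comp measurable_snd
      unfold Function.uncurry
      fun_prop
    have hInt : Integrable (fun θ : sphere (0 : EuclideanSpace ℝ (Fin d)) 1 =>
        ∫ u in Set.Ioi (0 : ℝ),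
          (1 - Real.cos (s * u * ⟪θ₀, (θ : EuclideanSpace ℝ (Fin d))⟫)) * f (1 / u) / u) m :=
      (integrable_const (2 * C * f s)).mono' hmeas (Eventually.of_forall fun θ => by
        rw [Real.norm_of_nonneg (hI0 s _ hs0.le (hinner θ₀ hθ₀ θ))]
        exact hIle s s _ hs0.le le_rfl hs (hinner θ₀ hθ₀ θ))
    have hc : Continuous fun θ : sphere (0 : EuclideanSpace ℝ (Fin d)) 1 =>
        1 / (4 * Real.pi ^ 2 * K) * f s * ⟪θ₀, (θ : EuclideanSpace ℝ (Fin d))⟫ ^ 2 := by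
      fun_prop
    calc 1 / (4 * Real.pi ^ 2 * K) * q * f s = 1 / (4 * Real.pi ^ 2 * K) * f s * q := by ring
      _ ≤ 1 / (4 * Real.pi ^ 2 * K) * f s *
          ∫ θ : sphere (0 : EuclideanSpace ℝ (Fin d)) 1,
            ⟪θ₀, (θ : EuclideanSpace ℝ (Fin d))⟫ ^ 2 ∂m :=
          mul_le_mul_of_nonneg_left (hqle θ₀ hθ₀) (by positivity)
      _ ≤ _ := by
          rw [← integral_const_mul]
          refine integral_mono
            (hc.integrable_of_hasCompactSupport (HasCompactSupport.of_compactSpace _)) hInt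
            fun θ => ?_
          refine mul_sq_le_integral_one_sub_cos_mul hfpos hK hs0 (hinner θ₀ hθ₀ θ)
            (fun l hl => ?_) (hIi s _ hs0.le (hinner θ₀ hθ₀ θ))
          exact (le_mul_of_one_le_left hfs.le (Real.one_le_rpow hl hγ.le)).trans
            (hpot s hs l hl).2
  obtain ⟨e, he⟩ := exists_norm_eq (EuclideanSpace ℝ (Fin d)) (zero_le_one (α := ℝ))
  refine ⟨s₀, hs₀, ⟨1 / (4 * Real.pi ^ 2 * K) * q, by positivity, m.real Set.univ * (2 * C),
    by positivity, fun θ₀ hθ₀ s hs => ⟨hlower θ₀ hθ₀ s hs,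
      hupper θ₀ hθ₀ s s (by linarith) le_rfl hs⟩⟩,
    1 / (4 * Real.pi ^ 2 * K) * q, by positivity, m.real Set.univ * (2 * C), by positivity,
    fun s hs => ?_⟩
  have hs0 : 0 < s := by linarith
  have hbound : ∀ z ∈ {z : ℝ | ∃ θ : EuclideanSpace ℝ (Fin d), ∃ u : ℝ,
      ‖θ‖ = 1 ∧ 0 < u ∧ u ≤ s ∧ z = ψ (u • θ)}, z ≤ m.real Set.univ * (2 * C) * f s := by
    rintro z ⟨θ, u, hθ, hu, hus, rfl⟩
    exact hupper θ hθ u s hu.le hus hs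
  have hmem : ψ (s • e) ∈ {z : ℝ | ∃ θ : EuclideanSpace ℝ (Fin d), ∃ u : ℝ,
      ‖θ‖ = 1 ∧ 0 < u ∧ u ≤ s ∧ z = ψ (u • θ)} := ⟨e, s, he, hs0, le_rfl, rfl⟩
  exact ⟨(hlower e he s hs).trans (le_csSup ⟨_, hbound⟩ hmem), csSup_le ⟨_, hmem⟩ hbound⟩
end

section
/- Let d ≥ 1, fix β ∈ (0, 2), and let (p_t)_{t≥0} be the marginal laws of a symmetric Lévy process on ℝ^d with (real, nonnegative) characteristic exponent ψ. Assume: (a) there are constants c₁, c₂ > 0 with c₁ ψ*(‖x‖) ≤ ψ(x) ≤ c₂ ψ*(‖x‖) for all ‖x‖ ≥ 1; (b) there exist V ∈ R_α with α ∈ (β, 2] and a continuous function Λ : S^{d−1} → (0,∞) such that lim_{s→∞} ψ(sθ)/V(s) = Λ(θ) for every θ ∈ S^{d−1}. Then for every ε ∈ (0, α − β) there is a constant C > 0 such that for every M > 1, limsup_{t→0+} [V^−(1/t)]^β ∫_{‖x‖ > M/V^−(1/t)} min(1, ‖x‖^β) p_t(dx) ≤ C · M^{β − α + ε}. -/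
open MeasureTheory Filter
open scoped Topology RealInnerProductSpace ENNReal

/-- The tail of a probability measure is controlled by its characteristic function near `0`. -/
lemma measureReal_norm_gt_le_of_charFun {d : ℕ} (hd : 1 ≤ d)
    (μ : Measure (EuclideanSpace ℝ (Fin d))) [IsProbabilityMeasure μ] {r K : ℝ} (hr : 0 < r)
    (hK : ∀ ξ : EuclideanSpace ℝ (Fin d), ‖ξ‖ ≤ 2 * d / r → ‖1 - charFun μ ξ‖ ≤ K) :
    μ.real {x | r < ‖x‖} ≤ 2 * d * K := by
  have hd0 : (0 : ℝ) < d := by exact_mod_cast hd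
  set e : Fin d → EuclideanSpace ℝ (Fin d) := fun i => EuclideanSpace.single i 1
  have hsub : {x : EuclideanSpace ℝ (Fin d) | r < ‖x‖} ⊆
      ⋃ i, {x | r / d < |⟪e i, x⟫|} := by
    intro x hx
    simp only [Set.mem_iUnion, Set.mem_ofPred_eq] at hx ⊢
    by_contra! hcon
    have hle : ‖x‖ ≤ ∑ i : Fin d, |⟪e i, x⟫| := by
      calc ‖x‖ = ‖∑ i : Fin d, ⟪e i, x⟫ • e i‖ := by
            congr 1
            have := (EuclideanSpace.basisFun (Fin d) ℝ).sum_repr' x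
            simpa [e] using this.symm
        _ ≤ ∑ i : Fin d, ‖⟪e i, x⟫ • e i‖ := norm_sum_le _ _
        _ = ∑ i : Fin d, |⟪e i, x⟫| := by simp [norm_smul, e]
    have hsum : ∑ i : Fin d, |⟪e i, x⟫| ≤ ∑ _i : Fin d, r / d :=
      Finset.sum_le_sum fun i _ => hcon i
    rw [Finset.sum_const, Finset.card_univ, Fintype.card_fin, nsmul_eq_mul,
      mul_div_cancel₀ _ hd0.ne'] at hsum
    linarith
  have hcoord (i : Fin d) : μ.real {x | r / d < |⟪e i, x⟫|} ≤ 2 * K := by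
    have hρ : 0 < r / d := by positivity
    refine (measureReal_abs_inner_gt_le_integral_charFun hρ).trans ?_
    have hint : ‖∫ s in -2 * (r / d)⁻¹..2 * (r / d)⁻¹, 1 - charFun μ (s • e i)‖ ≤
        K * |2 * (r / d)⁻¹ - -2 * (r / d)⁻¹| := by
      refine intervalIntegral.norm_integral_le_of_norm_le_const fun s hs => hK _ ?_
      have hs' : |s| ≤ 2 * (r / d)⁻¹ := by
        rw [Set.uIoc_of_le (by nlinarith [inv_pos.2 hρ])] at hs
        exact abs_le.2 ⟨by linarith [hs.1], hs.2⟩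
      simpa [norm_smul, e, mul_div_assoc] using hs'
    calc 2⁻¹ * (r / d) * ‖∫ s in -2 * (r / d)⁻¹..2 * (r / d)⁻¹, 1 - charFun μ (s • e i)‖
        ≤ 2⁻¹ * (r / d) * (K * |2 * (r / d)⁻¹ - -2 * (r / d)⁻¹|) := by gcongr
      _ = 2 * K := by
        rw [abs_of_pos (by nlinarith [inv_pos.2 hρ])]
        field_simp
        ring
  calc μ.real {x | r < ‖x‖} ≤ μ.real (⋃ i, {x | r / d < |⟪e i, x⟫|}) := measureReal_mono hsub
    _ ≤ ∑ i : Fin d, μ.real {x | r / d < |⟪e i, x⟫|} := measureReal_iUnion_fintype_le _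
    _ ≤ ∑ _i : Fin d, 2 * K := Finset.sum_le_sum fun i _ => hcoord i
    _ = 2 * d * K := by simp; ring

lemma integrable_min_one_norm_rpow {E : Type*} [NormedAddCommGroup E] [MeasurableSpace E]
    [OpensMeasurableSpace E] (μ : Measure E) [IsFiniteMeasure μ] (β : ℝ) :
    Integrable (fun x => min 1 (‖x‖ ^ β)) μ := by
  refine Integrable.of_bound (by fun_prop : Measurable _).aestronglyMeasurable 1 (ae_of_all _ ?_)
  intro x
  rw [Real.norm_of_nonneg (le_min zero_le_one (by positivity))]
  exact min_le_left _ _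

lemma setIntegral_min_one_norm_rpow_le_measureReal {E : Type*} [NormedAddCommGroup E]
    [MeasurableSpace E] [OpensMeasurableSpace E] (μ : Measure E) [IsFiniteMeasure μ] (β : ℝ)
    (s : Set E) : ∫ x in s, min 1 (‖x‖ ^ β) ∂μ ≤ μ.real s := by
  calc ∫ x in s, min 1 (‖x‖ ^ β) ∂μ ≤ ∫ _x in s, (1 : ℝ) ∂μ :=
        integral_mono (integrable_min_one_norm_rpow _ β) (integrable_const _)
          fun x => min_le_left _ _
    _ = μ.real s := by simp

/-- Geometric decay of the dyadic tails gives geometric decay of the truncated moments. -/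
lemma rpow_mul_setIntegral_dyadic_le {E : Type*} [NormedAddCommGroup E] [MeasurableSpace E]
    [OpensMeasurableSpace E] (μ : Measure E) [IsFiniteMeasure μ] {β h a K c : ℝ}
    (hβ : 0 ≤ β) (hh : 0 < h) (ha : 0 < a) (hab : (2 : ℝ) ^ β * a < 1) (hK : 0 ≤ K)
    {j N : ℕ} (hjN : j ≤ N) (hN : h ^ β ≤ c * ((2 : ℝ) ^ β) ^ N)
    (htail : ∀ n ≤ N, μ.real {x | 2 ^ n / h < ‖x‖} ≤ K * a ^ n) :
    h ^ β * ∫ x in {x | 2 ^ j / h < ‖x‖}, min 1 (‖x‖ ^ β) ∂μ ≤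
      (2 ^ β / (1 - 2 ^ β * a) + c) * K * (2 ^ β * a) ^ j := by
  set b : ℝ := (2 : ℝ) ^ β
  have hb : 0 < b := by positivity
  have hD : 0 < 1 - b * a := by linarith
  have hc : 0 ≤ c := by
    by_contra! hneg
    have h1 : 0 < h ^ β := by positivity
    nlinarith [pow_pos hb N]
  have hmeas (n : ℕ) : MeasurableSet {x : E | 2 ^ n / h < ‖x‖} :=
    measurableSet_lt measurable_const measurable_norm
  refine Nat.decreasingInduction' (P := fun n =>
    h ^ β * ∫ x in {x | 2 ^ n / h < ‖x‖}, min 1 (‖x‖ ^ β) ∂μ ≤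
      (b / (1 - b * a) + c) * K * (b * a) ^ n) (fun n hn _ ih => ?_) hjN ?_
  · set S := {x : E | 2 ^ n / h < ‖x‖}
    set S' := {x : E | 2 ^ (n + 1) / h < ‖x‖}
    have hsub : S' ⊆ S := by
      intro x hx
      simp only [S, S', Set.mem_ofPred_eq] at hx ⊢
      refine lt_of_le_of_lt ?_ hx
      gcongr
      · norm_num
      · omega
    have hsplit : ∫ x in S, min 1 (‖x‖ ^ β) ∂μ =
        ∫ x in S \ S', min 1 (‖x‖ ^ β) ∂μ + ∫ x in S', min 1 (‖x‖ ^ β) ∂μ := by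
      rw [← setIntegral_union Set.disjoint_sdiff_left (hmeas _)
        (integrable_min_one_norm_rpow _ β) (integrable_min_one_norm_rpow _ β),
        Set.sdiff_union_of_subset hsub]
    have hshell : ∫ x in S \ S', min 1 (‖x‖ ^ β) ∂μ ≤ (2 ^ (n + 1) / h) ^ β * (K * a ^ n) := by
      calc ∫ x in S \ S', min 1 (‖x‖ ^ β) ∂μ ≤ ∫ _x in S \ S', (2 ^ (n + 1) / h) ^ β ∂μ := by
            refine setIntegral_mono_on (integrable_min_one_norm_rpow _ β) (integrable_const _)
              ((hmeas _).diff (hmeas _)) fun x hx => (min_le_right _ _).trans ?_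
            exact Real.rpow_le_rpow (norm_nonneg _) (not_lt.1 hx.2) hβ
        _ = (2 ^ (n + 1) / h) ^ β * μ.real (S \ S') := by simp [mul_comm]
        _ ≤ (2 ^ (n + 1) / h) ^ β * (K * a ^ n) := by
            gcongr
            exact (measureReal_mono Set.sdiff_subset).trans (htail n hn.le)
    have hscale : h ^ β * (2 ^ (n + 1) / h) ^ β = b ^ (n + 1) := by
      rw [← Real.mul_rpow hh.le (by positivity), mul_div_cancel₀ _ hh.ne']
      simp only [b]
      rw [← Real.rpow_natCast, ← Real.rpow_natCast, ← Real.rpow_mul (by norm_num),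
        ← Real.rpow_mul (by norm_num), mul_comm]
    calc h ^ β * ∫ x in S, min 1 (‖x‖ ^ β) ∂μ
        = h ^ β * ∫ x in S \ S', min 1 (‖x‖ ^ β) ∂μ
          + h ^ β * ∫ x in S', min 1 (‖x‖ ^ β) ∂μ := by rw [hsplit]; ring
      _ ≤ h ^ β * ((2 ^ (n + 1) / h) ^ β * (K * a ^ n))
          + (b / (1 - b * a) + c) * K * (b * a) ^ (n + 1) := by gcongr
      _ = b * K * (b * a) ^ n + (b / (1 - b * a) + c) * K * (b * a) ^ (n + 1) := by
          rw [← mul_assoc, hscale, mul_pow]; ring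
      _ = (b / (1 - b * a) + c * (b * a)) * K * (b * a) ^ n := by
          rw [pow_succ]; field_simp; ring
      _ ≤ (b / (1 - b * a) + c) * K * (b * a) ^ n := by
          gcongr
          exact mul_le_of_le_one_right hc hab.le
  · calc h ^ β * ∫ x in {x | 2 ^ N / h < ‖x‖}, min 1 (‖x‖ ^ β) ∂μ
        ≤ c * b ^ N * (K * a ^ N) := by
          refine mul_le_mul hN ((setIntegral_min_one_norm_rpow_le_measureReal _ _ _).trans
            (htail N le_rfl)) (integral_nonneg fun x => le_min zero_le_one (by positivity))
            (by positivity)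
      _ = c * K * (b * a) ^ N := by rw [mul_pow]; ring
      _ ≤ (b / (1 - b * a) + c) * K * (b * a) ^ N := by
          gcongr
          linarith [div_pos hb hD]

/-- A function of regular variation of index `α > γ` eventually grows at least like `s ^ γ` along
geometric sequences of ratio `2`. -/
lemma exists_le_rpow_pow_mul_of_regularlyVarying {V : ℝ → ℝ} {α γ : ℝ} (hγ : γ < α)
    (hVpos : ∀ s, 0 < s → 0 < V s)
    (hVreg : Tendsto (fun s => V (2 * s) / V s) atTop (𝓝 ((2 : ℝ) ^ α))) :
    ∃ s₀ > 0, ∀ s ≥ s₀, ∀ n : ℕ, V s ≤ ((2 : ℝ) ^ (-γ)) ^ n * V (2 ^ n * s) := by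
  have hlt : (2 : ℝ) ^ γ < 2 ^ α := Real.rpow_lt_rpow_of_exponent_lt (by norm_num) hγ
  obtain ⟨s₀, hs₀⟩ := eventually_atTop.1
    ((hVreg.eventually_const_le hlt).and (eventually_gt_atTop 0))
  refine ⟨s₀, (hs₀ s₀ le_rfl).2, fun s hs n => ?_⟩
  induction n with
  | zero => simp
  | succ n ih =>
    have hspos : 0 < s := (hs₀ s hs).2
    have hge : s ≤ 2 ^ n * s := le_mul_of_one_le_left hspos.le (one_le_pow₀ (by norm_num))
    have h1 := (hs₀ _ (hs.le.trans hge)).1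
    rw [le_div_iff₀ (hVpos _ (by positivity))] at h1
    have h2 : V (2 ^ n * s) ≤ 2 ^ (-γ) * V (2 * (2 ^ n * s)) := by
      rw [Real.rpow_neg (by norm_num), ← div_eq_inv_mul, le_div_iff₀' (by positivity)]
      exact h1
    calc V s ≤ ((2 : ℝ) ^ (-γ)) ^ n * V (2 ^ n * s) := ih
      _ ≤ ((2 : ℝ) ^ (-γ)) ^ n * (2 ^ (-γ) * V (2 * (2 ^ n * s))) := by gcongr
      _ = ((2 : ℝ) ^ (-γ)) ^ (n + 1) * V (2 ^ (n + 1) * s) := by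
        rw [pow_succ, mul_assoc]; congr 3; ring

/-- If a probability measure has characteristic function `exp (-ψ)` with `ψ` real, then `ψ` is
nonnegative and continuous. -/
lemma nonneg_and_continuous_of_charFun_eq {E : Type*} [NormedAddCommGroup E]
    [InnerProductSpace ℝ E] [FiniteDimensional ℝ E] [MeasurableSpace E] [BorelSpace E]
    (μ : Measure E) [IsProbabilityMeasure μ] {ψ : E → ℝ}
    (h : ∀ ξ, charFun μ ξ = Complex.exp (-(ψ ξ : ℝ))) : (∀ ξ, 0 ≤ ψ ξ) ∧ Continuous ψ := by
  have hnorm (ξ : E) : ‖charFun μ ξ‖ = Real.exp (-ψ ξ) := by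
    rw [h, Complex.norm_exp]; simp
  have hlog : ψ = fun ξ => -Real.log ‖charFun μ ξ‖ := by
    funext ξ; rw [hnorm, Real.log_exp, neg_neg]
  refine ⟨fun ξ => ?_, ?_⟩
  · have := norm_charFun_le_one (μ := μ) ξ
    rw [hnorm, Real.exp_le_one_iff] at this
    linarith
  · rw [hlog]
    exact (continuous_charFun.norm.log fun ξ => by rw [hnorm]; positivity).neg

/-- The tail estimate from the proof of Theorem 2: under the multivariate
regular variation conditions on the symmetric exponent ψ, for every
ε ∈ (0, α − β) there is C > 0 such that for every M > 1,
limsup_{t→0+} [V⁻(1/t)]^β ∫_{‖x‖ > M/V⁻(1/t)} min(1, ‖x‖^β) p_t(dx)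
  ≤ C·M^{β−α+ε}. -/
theorem heat_content_tail_estimate
    (d : ℕ) (hd : 1 ≤ d) (β : ℝ) (hβ0 : 0 < β) (hβ2 : β < 2)
    -- symmetric Lévy process: triplet (A, 0, ν)
    (A : EuclideanSpace ℝ (Fin d) →L[ℝ] EuclideanSpace ℝ (Fin d))
    (hAsym : ∀ x y, ⟪A x, y⟫ = ⟪x, A y⟫) (hApos : ∀ x, 0 ≤ ⟪x, A x⟫)
    (ν : Measure (EuclideanSpace ℝ (Fin d)))
    (hν0 : ν {0} = 0)
    (hνlevy : ∫⁻ y, ENNReal.ofReal (min 1 (‖y‖ ^ 2)) ∂ν < ⊤)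
    (hνsym : ν.map (fun y => -y) = ν)
    -- the (real, nonnegative) characteristic exponent
    (ψ : EuclideanSpace ℝ (Fin d) → ℝ)
    (hψ : ∀ ξ, ψ ξ = ⟪ξ, A ξ⟫ + ∫ y, (1 - Real.cos ⟪ξ, y⟫) ∂ν)
    -- (p t) are the marginal laws of the process
    (p : ℝ → Measure (EuclideanSpace ℝ (Fin d)))
    (hp : ∀ t, 0 ≤ t → IsProbabilityMeasure (p t))
    (hchar : ∀ t, 0 ≤ t → ∀ ξ,
      ∫ x, Complex.exp (Complex.I * (⟪ξ, x⟫ : ℂ)) ∂(p t)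
        = Complex.exp (-(t * ψ ξ : ℝ)))
    -- ψ*(u) = sup_{‖x‖ ≤ u} ψ(x) and condition (a): ψ ≍ ψ* for ‖x‖ ≥ 1
    (ψs : ℝ → ℝ)
    (hψs : ∀ u, ψs u = sSup (ψ '' {x : EuclideanSpace ℝ (Fin d) | ‖x‖ ≤ u}))
    (c₁ c₂ : ℝ) (hc₁ : 0 < c₁) (hc₂ : 0 < c₂)
    (hcomp : ∀ x : EuclideanSpace ℝ (Fin d), 1 ≤ ‖x‖ →
      c₁ * ψs ‖x‖ ≤ ψ x ∧ ψ x ≤ c₂ * ψs ‖x‖)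
    -- condition (b): V regularly varying of index α ∈ (β, 2], Λ continuous positive
    (α : ℝ) (hαβ : β < α) (hα2 : α ≤ 2)
    (V : ℝ → ℝ) (hVmeas : Measurable V) (hVpos : ∀ s, 0 < s → 0 < V s)
    (hVreg : ∀ l : ℝ, 0 < l →
      Tendsto (fun s => V (l * s) / V s) atTop (𝓝 (l ^ α)))
    (Λ : EuclideanSpace ℝ (Fin d) → ℝ)
    (hΛcont : ContinuousOn Λ (Metric.sphere (0 : EuclideanSpace ℝ (Fin d)) 1))
    (hΛpos : ∀ θ : EuclideanSpace ℝ (Fin d), ‖θ‖ = 1 → 0 < Λ θ)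
    (hΛlim : ∀ θ : EuclideanSpace ℝ (Fin d), ‖θ‖ = 1 →
      Tendsto (fun s : ℝ => ψ (s • θ) / V s) atTop (𝓝 (Λ θ)))
    -- the generalized inverse V⁻
    (Vinv : ℝ → ℝ) (hVinv : ∀ u, Vinv u = sInf {x : ℝ | 0 ≤ x ∧ u ≤ V x}) :
    ∀ ε : ℝ, 0 < ε → ε < α - β → ∃ C > (0 : ℝ), ∀ M : ℝ, 1 < M →
      Filter.limsup
        (fun t : ℝ => (Vinv (1 / t)) ^ β *
          ∫ x in {x : EuclideanSpace ℝ (Fin d) | M / Vinv (1 / t) < ‖x‖},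
            min 1 (‖x‖ ^ β) ∂(p t))
        (𝓝[>] 0) ≤ C * M ^ (β - α + ε) := by
  intro ε hε hεlt
  set γ : ℝ := α - ε with hγdef
  have hd0 : (0 : ℝ) < d := by exact_mod_cast hd
  have hd1 : (1 : ℝ) ≤ d := by exact_mod_cast hd
  have hcharFun (t : ℝ) (ht : 0 ≤ t) (ξ : EuclideanSpace ℝ (Fin d)) :
      charFun (p t) ξ = Complex.exp (-(t * ψ ξ : ℝ)) := by
    rw [← hchar t ht ξ, charFun_apply]
    refine integral_congr_ae (ae_of_all _ fun x => ?_)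
    simp only [real_inner_comm, mul_comm]
  obtain ⟨hψ0, hψcont⟩ : (∀ ξ, 0 ≤ ψ ξ) ∧ Continuous ψ := by
    have := hp 1 zero_le_one
    exact nonneg_and_continuous_of_charFun_eq (p 1)
      fun ξ => by simpa using hcharFun 1 zero_le_one ξ
  have hψle (u : ℝ) (ξ : EuclideanSpace ℝ (Fin d)) (hξ : ‖ξ‖ ≤ u) : ψ ξ ≤ ψs u := by
    rw [hψs]
    refine le_csSup ?_ ⟨ξ, hξ, rfl⟩
    have hball : {x : EuclideanSpace ℝ (Fin d) | ‖x‖ ≤ u} = Metric.closedBall 0 u := by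
      ext x; simp
    rw [hball]
    exact (isCompact_closedBall _ _).bddAbove_image hψcont.continuousOn
  have hψs0 (u : ℝ) (hu : 0 ≤ u) : 0 ≤ ψs u := (hψ0 0).trans (hψle u 0 (by simpa using hu))
  have htail (t : ℝ) (ht : 0 ≤ t) (r : ℝ) (hr : 0 < r) :
      (p t).real {x | r < ‖x‖} ≤ 2 * d * (t * ψs (2 * d / r)) := by
    have := hp t ht
    refine measureReal_norm_gt_le_of_charFun hd (p t) hr fun ξ hξ => ?_
    have hnn : 0 ≤ t * ψ ξ := mul_nonneg ht (hψ0 ξ)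
    have hle : Real.exp (-(t * ψ ξ)) ≤ 1 := Real.exp_le_one_iff.2 (by linarith)
    rw [hcharFun t ht, ← Complex.ofReal_neg, ← Complex.ofReal_exp, ← Complex.ofReal_one,
      ← Complex.ofReal_sub, Complex.norm_real, Real.norm_of_nonneg (by linarith)]
    calc 1 - Real.exp (-(t * ψ ξ)) ≤ t * ψ ξ := by
          linarith [Real.add_one_le_exp (-(t * ψ ξ))]
      _ ≤ t * ψs (2 * d / r) := by
          gcongr
          exact hψle _ _ hξ
  -- comparison of `ψs` with `V`
  obtain ⟨L, hL, s₁, hs₁, hψV⟩ : ∃ L > 0, ∃ s₁ ≥ (1 : ℝ), ∀ s ≥ s₁,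
      ψs (4 * d * s) ≤ L * V s := by
    set θ : EuclideanSpace ℝ (Fin d) := EuclideanSpace.single ⟨0, hd⟩ 1
    have hθ : ‖θ‖ = 1 := by simp [θ]
    have hΛθ := hΛpos θ hθ
    obtain ⟨u₁, hu₁⟩ := eventually_atTop.1
      ((hΛlim θ hθ).eventually_le_const (lt_two_mul_self hΛθ))
    obtain ⟨u₂, hu₂⟩ := eventually_atTop.1
      ((hVreg (4 * d) (by positivity)).eventually_le_const (lt_add_one _))
    refine ⟨2 * Λ θ / c₁ * ((4 * d) ^ α + 1), by positivity, max 1 (max u₁ u₂),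
      le_max_left _ _, fun s hs => ?_⟩
    simp only [ge_iff_le, max_le_iff] at hs
    obtain ⟨hs1, hsu₁, hsu₂⟩ := hs
    have hs0 : 0 < s := by linarith
    have hds : s ≤ 4 * d * s := le_mul_of_one_le_left hs0.le (by linarith)
    have h1 := hu₁ (4 * d * s) (hsu₁.trans hds)
    have h2 := hu₂ s hsu₂
    rw [div_le_iff₀ (hVpos _ (by positivity))] at h1 h2
    have hnorm : ‖(4 * d * s) • θ‖ = 4 * d * s := by
      rw [norm_smul, hθ, mul_one, Real.norm_of_nonneg (by positivity)]
    have h3 := (hcomp ((4 * d * s) • θ) (by rw [hnorm]; linarith)).1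
    rw [hnorm] at h3
    rw [div_mul_eq_mul_div, div_mul_eq_mul_div, le_div_iff₀ hc₁]
    calc ψs (4 * d * s) * c₁ ≤ 2 * Λ θ * V (4 * d * s) := by linarith
      _ ≤ 2 * Λ θ * (((4 * d) ^ α + 1) * V s) := by gcongr
      _ = 2 * Λ θ * ((4 * d) ^ α + 1) * V s := by ring
  obtain ⟨s₂, hs₂, hVgeom⟩ := exists_le_rpow_pow_mul_of_regularlyVarying
    (show γ < α by linarith) hVpos (hVreg 2 two_pos)
  set s₀ : ℝ := max s₁ s₂
  have hs₀ : 0 < s₀ := lt_max_of_lt_right hs₂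
  have hVinv0 (u : ℝ) : 0 ≤ Vinv u := by
    rw [hVinv]; exact Real.sInf_nonneg fun x hx => hx.1
  have hVlt (u x : ℝ) (hx : 0 ≤ x) (hxu : x < Vinv u) : V x < u := by
    by_contra! hge
    rw [hVinv] at hxu
    exact hxu.not_ge (csInf_le ⟨0, fun y hy => hy.1⟩ ⟨hx, hge⟩)
  set a : ℝ := (2 : ℝ) ^ (-γ) with hadef
  have ha : 0 < a := by positivity
  have hba : (2 : ℝ) ^ β * a = 2 ^ (β - γ) := by
    rw [hadef, ← Real.rpow_add two_pos, sub_eq_add_neg]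
  have hba1 : (2 : ℝ) ^ β * a < 1 := by
    rw [hba]; exact Real.rpow_lt_one_of_one_lt_of_neg one_lt_two (by linarith)
  set K : ℝ := 2 * d * L
  have hK : 0 < K := by positivity
  set c : ℝ := (4 * s₀) ^ β
  have hc : 0 < c := by positivity
  have hden : 0 < 1 - (2 : ℝ) ^ β * a := by linarith
  set C₀ : ℝ := (2 ^ β / (1 - 2 ^ β * a) + c) * K
  have hC₀ : 0 < C₀ := by positivity
  refine ⟨C₀ * 2 ^ (γ - β), by positivity, fun M hM => ?_⟩
  have hM0 : 0 < M := by linarith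
  obtain ⟨j, hjM, hMj⟩ := exists_nat_pow_near hM.le one_lt_two
  set H : ℝ := 2 ^ (j + 1) * s₀
  have hH : 0 < H := by positivity
  have hlarge (t : ℝ) (ht : 0 < t) (hHt : H ≤ Vinv (1 / t)) :
      (Vinv (1 / t)) ^ β * ∫ x in {x : EuclideanSpace ℝ (Fin d) | M / Vinv (1 / t) < ‖x‖},
        min 1 (‖x‖ ^ β) ∂(p t) ≤ C₀ * 2 ^ (γ - β) * M ^ (β - α + ε) := by
    have := hp t ht.le
    set h : ℝ := Vinv (1 / t)
    have hh : 0 < h := hH.trans_le hHt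
    have hratio : (2 : ℝ) ^ j ≤ h / (2 * s₀) := by
      rw [le_div_iff₀ (by positivity)]
      calc (2 : ℝ) ^ j * (2 * s₀) = H := by simp only [H]; ring
        _ ≤ h := hHt
    obtain ⟨N, hN, hN'⟩ := exists_nat_pow_near
      ((one_le_pow₀ one_le_two).trans hratio) (one_lt_two (α := ℝ))
    have hjN : j ≤ N := by
      have := (pow_lt_pow_iff_right₀ (one_lt_two (α := ℝ))).1 (hratio.trans_lt hN')
      omega
    have hhN : h ^ β ≤ c * ((2 : ℝ) ^ β) ^ N := by
      rw [← Real.rpow_natCast, ← Real.rpow_mul two_pos.le, mul_comm β, Real.rpow_mul two_pos.le,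
        Real.rpow_natCast, ← Real.mul_rpow (by positivity) (by positivity)]
      refine Real.rpow_le_rpow hh.le ?_ hβ0.le
      rw [div_lt_iff₀ (by positivity), pow_succ] at hN'
      linarith
    have hdyadic : ∀ n ≤ N, (p t).real {x | 2 ^ n / h < ‖x‖} ≤ K * a ^ n := by
      intro n hn
      set s : ℝ := h / 2 ^ (n + 1) with hsdef
      have hs : s₀ ≤ s := by
        rw [hsdef, le_div_iff₀ (by positivity)]
        have h1 : (2 : ℝ) ^ n ≤ h / (2 * s₀) :=
          (pow_le_pow_right₀ one_le_two hn).trans hN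
        rw [le_div_iff₀ (by positivity)] at h1
        rw [pow_succ]; linarith
      have h1 := htail t ht.le (2 ^ n / h) (by positivity)
      have h2 : 2 * d / (2 ^ n / h) = 4 * d * s := by
        rw [hsdef, pow_succ]; field_simp; norm_num
      have h3 : 2 ^ n * s = h / 2 := by
        rw [hsdef, pow_succ]; field_simp
      have h4 := hVgeom s ((le_max_right _ _).trans hs) n
      rw [h3] at h4
      have h5 : V (h / 2) < 1 / t := hVlt _ _ (by positivity) (half_lt_self hh)
      rw [lt_div_iff₀ ht] at h5
      rw [h2] at h1
      calc (p t).real {x | 2 ^ n / h < ‖x‖} ≤ 2 * d * (t * ψs (4 * d * s)) := h1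
        _ ≤ 2 * d * (t * (L * (a ^ n * V (h / 2)))) := by
          have h6 := (hψV s ((le_max_left _ _).trans hs)).trans
            (mul_le_mul_of_nonneg_left h4 hL.le)
          gcongr
        _ = K * a ^ n * (V (h / 2) * t) := by simp only [K]; ring
        _ ≤ K * a ^ n := mul_le_of_le_one_right (by positivity) h5.le
    have hmain := rpow_mul_setIntegral_dyadic_le (p t) hβ0.le hh ha hba1 hK.le hjN hhN hdyadic
    have hpow : ((2 : ℝ) ^ β * a) ^ j ≤ 2 ^ (γ - β) * M ^ (β - α + ε) := by
      have h1 : ((2 : ℝ) ^ β * a) ^ j = 2 ^ (γ - β) * (2 ^ (j + 1)) ^ (β - γ) := by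
        rw [hba, ← Real.rpow_natCast, ← Real.rpow_natCast, ← Real.rpow_mul two_pos.le,
          ← Real.rpow_mul two_pos.le, ← Real.rpow_add two_pos]
        congr 1; push_cast; ring
      rw [h1, show β - α + ε = β - γ by rw [hγdef]; ring]
      exact mul_le_mul_of_nonneg_left
        (Real.rpow_le_rpow_of_nonpos hM0 hMj.le (by linarith)) (by positivity)
    have hmono : ∫ x in {x : EuclideanSpace ℝ (Fin d) | M / h < ‖x‖}, min 1 (‖x‖ ^ β) ∂(p t) ≤
        ∫ x in {x : EuclideanSpace ℝ (Fin d) | 2 ^ j / h < ‖x‖}, min 1 (‖x‖ ^ β) ∂(p t) := by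
      refine setIntegral_mono_set (integrable_min_one_norm_rpow _ β)
        (ae_of_all _ fun x => le_min zero_le_one (by positivity))
        (LE.le.eventuallyLE ?_)
      intro x hx
      simp only [Set.mem_ofPred_eq] at hx ⊢
      exact lt_of_le_of_lt (by gcongr) hx
    calc h ^ β * ∫ x in {x : EuclideanSpace ℝ (Fin d) | M / h < ‖x‖}, min 1 (‖x‖ ^ β) ∂(p t)
        ≤ h ^ β * ∫ x in {x : EuclideanSpace ℝ (Fin d) | 2 ^ j / h < ‖x‖},
            min 1 (‖x‖ ^ β) ∂(p t) := by gcongr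
      _ ≤ C₀ * (2 ^ β * a) ^ j := hmain
      _ ≤ C₀ * (2 ^ (γ - β) * M ^ (β - α + ε)) := by gcongr
      _ = C₀ * 2 ^ (γ - β) * M ^ (β - α + ε) := by ring
  have hsmall (t : ℝ) (ht : 0 < t) (hHt : Vinv (1 / t) < H) :
      (Vinv (1 / t)) ^ β * ∫ x in {x : EuclideanSpace ℝ (Fin d) | M / Vinv (1 / t) < ‖x‖},
        min 1 (‖x‖ ^ β) ∂(p t) ≤ H ^ β * (2 * d * ψs (2 * d / (M / H))) * t := by
    have := hp t ht.le
    have hbd := htail t ht.le (M / H) (by positivity)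
    have hrhs := hψs0 (2 * d / (M / H)) (by positivity)
    rcases (hVinv0 (1 / t)).eq_or_lt with h0 | hpos
    · rw [← h0, Real.zero_rpow hβ0.ne', zero_mul]
      positivity
    · have hsub : {x : EuclideanSpace ℝ (Fin d) | M / Vinv (1 / t) < ‖x‖} ⊆
          {x | M / H < ‖x‖} := by
        intro x hx
        simp only [Set.mem_ofPred_eq] at hx ⊢
        exact lt_of_le_of_lt (by gcongr) hx
      calc (Vinv (1 / t)) ^ β * ∫ x in {x : EuclideanSpace ℝ (Fin d) | M / Vinv (1 / t) < ‖x‖},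
            min 1 (‖x‖ ^ β) ∂(p t) ≤ H ^ β * (2 * d * (t * ψs (2 * d / (M / H)))) := by
            gcongr
            exact (setIntegral_min_one_norm_rpow_le_measureReal _ _ _).trans
              ((measureReal_mono hsub).trans hbd)
        _ = H ^ β * (2 * d * ψs (2 * d / (M / H))) * t := by ring
  have hlim : Tendsto (fun t : ℝ => H ^ β * (2 * d * ψs (2 * d / (M / H))) * t)
      (𝓝[>] 0) (𝓝 0) := by
    have : Tendsto (fun t : ℝ => H ^ β * (2 * d * ψs (2 * d / (M / H))) * t) (𝓝 0) (𝓝 _) :=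
      (continuous_const.mul continuous_id).tendsto 0
    simpa using this.mono_left nhdsWithin_le_nhds
  have hRHS : 0 < C₀ * 2 ^ (γ - β) * M ^ (β - α + ε) := by positivity
  refine limsup_le_of_le (IsCoboundedUnder.of_frequently_ge (a := 0)
    (Frequently.of_forall fun t => mul_nonneg (Real.rpow_nonneg (hVinv0 _) _)
      (integral_nonneg fun x => le_min zero_le_one (by positivity)))) ?_
  filter_upwards [hlim.eventually_le_const hRHS, self_mem_nhdsWithin] with t htle ht
  rcases le_or_gt H (Vinv (1 / t)) with hge | hlt
  · exact hlarge t ht hge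
  · exact (hsmall t ht hlt).trans htle
end
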